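/- arXiv:0904.3957 — 3 statements merged into one kernel-verified Lean document; each statement's English description precedes it below -/
import Mathlib

section
/- The standard monomials Δ(t), as t ranges over all standard tableaux in D(n,m) (including the empty one, with Δ = 1), form a ℂ-vector space basis of the polynomial ring ℂ[M_{n,m}]. -/
noncomputable section

/-- One-line tableau predicate: `isTab n m I J` says `[I:J]` is a one-line tableau in `D(n,m)`,
i.e. `I ⊆ {1,…,n}` and `J ⊆ {1,…,m}` are strictly increasing sequences of the same (positive) length. -/
def isTab (n m : ℕ) (I J : List ℕ) : Prop :=
  I.length = J.length ∧ I ≠ [] ∧ I.Chain' (· < ·) ∧ J.Chain' (· < ·) ∧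
    (∀ x ∈ I, 1 ≤ x ∧ x ≤ n) ∧ ∀ x ∈ J, 1 ≤ x ∧ x ≤ m

/-- The tableau order `A ⪯ B` on one-line tableaux. -/
def tleq (A B : List ℕ × List ℕ) : Prop :=
  B.1.length ≤ A.1.length ∧
    ∀ r < B.1.length, A.1.getD r 0 ≤ B.1.getD r 0 ∧ A.2.getD r 0 ≤ B.2.getD r 0

/-- `dmin n m I J` is the minor δ_{[I:J]} ∈ ℂ[M_{n,m}] : the determinant of the submatrix of
the generic n×m matrix of variables with rows `I` and columns `J` (1-based indices). -/
def dmin (n m : ℕ) (I J : List ℕ) : MvPolynomial (Fin n × Fin m) ℂ :=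
  Matrix.det (Matrix.of fun a b : Fin I.length =>
    if h : I.getD a 0 - 1 < n ∧ J.getD b 0 - 1 < m then
      MvPolynomial.X (⟨I.getD a 0 - 1, h.1⟩, ⟨J.getD b 0 - 1, h.2⟩)
    else 0)

section Straightening

variable {R : Type*} [CommRing R] {n N : ℕ}

/-- The maximal minor of the `N × n` matrix `y` on the rows `f 0, …, f (n - 1)`. -/
def maxMinor (y : Fin N → Fin n → R) (f : Fin n → Fin N) : R :=
  Matrix.det (Matrix.of fun p => y (f p))

/-- The sum of the row indices of a maximal minor. -/
def rowSum (f : Fin n → Fin N) : ℕ := ∑ p, (f p : ℕ)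

theorem maxMinor_comp_perm (y : Fin N → Fin n → R) (f : Fin n → Fin N) (σ : Equiv.Perm (Fin n)) :
    maxMinor y (f ∘ σ) = (Equiv.Perm.sign σ : ℤ) • maxMinor y f := by
  have h := Matrix.det_permute σ (Matrix.of fun p => y (f p))
  rw [zsmul_eq_mul]
  exact h

theorem rowSum_comp_perm (f : Fin n → Fin N) (σ : Equiv.Perm (Fin n)) :
    rowSum (f ∘ σ) = rowSum f :=
  Equiv.sum_comp σ fun p => (f p : ℕ)

theorem rowSum_le (f : Fin n → Fin N) : rowSum f ≤ n * N := by
  refine (Finset.sum_le_card_nsmul _ _ N fun p _ => (f p).2.le).trans ?_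
  simp

theorem maxMinor_eq_zero_of_not_injective (y : Fin N → Fin n → R) {f : Fin n → Fin N}
    (hf : ¬ Function.Injective f) : maxMinor y f = 0 := by
  simp only [Function.Injective, not_forall] at hf
  obtain ⟨a, b, hab, hne⟩ := hf
  exact Matrix.det_zero_of_row_eq hne (by ext; simp [hab])

/-- The positions of two maximal minors that take part in the exchange at position `r`. -/
abbrev ExchangePos (r : Fin n) := {p : Fin n // r ≤ p} ⊕ {p : Fin n // p ≤ r}

theorem card_exchangePos (r : Fin n) : Fintype.card (ExchangePos r) = n + 1 := by
  rw [Fintype.card_sum, Fintype.card_subtype, Fintype.card_subtype,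
    Finset.filter_le_eq_Ici, Finset.filter_ge_eq_Iic, Fin.card_Ici, Fin.card_Iic]
  have := r.2
  omega

theorem alternatingMap_eq_zero_of_card_lt {ι : Type*} [Fintype ι] (h : n < Fintype.card ι)
    (F : (Fin n → R) [⋀^ι]→ₗ[R] R) : F = 0 := by
  refine Module.Basis.ext_alternating (Pi.basisFun R (Fin n)) fun v hv => ?_
  have := Fintype.card_le_of_injective v hv
  simp at this
  omega

/-- The first factor after exchanging the entries along `σ`. -/
def exchangeLeft (f g : Fin n → Fin N) (r : Fin n) (σ : Equiv.Perm (ExchangePos r)) :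
    Fin n → Fin N :=
  fun p => if h : r ≤ p then
    Sum.elim (fun q => f q.1) (fun q => g q.1) (σ (Sum.inl ⟨p, h⟩)) else f p

/-- The second factor after exchanging the entries along `σ`. -/
def exchangeRight (f g : Fin n → Fin N) (r : Fin n) (σ : Equiv.Perm (ExchangePos r)) :
    Fin n → Fin N :=
  fun p => if h : p ≤ r then
    Sum.elim (fun q => f q.1) (fun q => g q.1) (σ (Sum.inr ⟨p, h⟩)) else g p

theorem sum_exchange_eq_zero (y : Fin N → Fin n → R) (f g : Fin n → Fin N) (r : Fin n) :
    ∑ σ : Equiv.Perm (ExchangePos r), (Equiv.Perm.sign σ : ℤ) •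
      (maxMinor y (exchangeLeft f g r σ) * maxMinor y (exchangeRight f g r σ)) = 0 := by
  let D : MultilinearMap R (fun _ : Fin n => Fin n → R) R :=
    (Matrix.detRowAlternating (n := Fin n) (R := R)).toMultilinearMap
  let F : MultilinearMap R (fun _ : ExchangePos r => Fin n → R) R :=
    (LinearMap.mul' R R).compMultilinearMap
      ((D.domDomRestrict (r ≤ ·) fun p => y (f p)).domCoprod
        (D.domDomRestrict (· ≤ r) fun p => y (g p)))
  have h0 : MultilinearMap.alternatization F = 0 :=
    alternatingMap_eq_zero_of_card_lt (by rw [card_exchangePos]; omega) _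
  have h1 := congrArg (fun G => G fun z =>
    y (Sum.elim (fun q => f q.1) (fun q => g q.1) z)) h0
  simp only [MultilinearMap.alternatization_apply, AlternatingMap.zero_apply] at h1
  rw [← h1]
  refine Finset.sum_congr rfl fun σ _ => ?_
  have key : ∀ z : R, (Equiv.Perm.sign σ : ℤ) • z = Equiv.Perm.sign σ • z := fun z => by
    rw [Units.smul_def]
  rw [key]
  congr 1
  simp only [F, MultilinearMap.domDomCongr_apply, LinearMap.compMultilinearMap_apply,
    MultilinearMap.domCoprod_apply, LinearMap.mul'_apply, MultilinearMap.domDomRestrict_apply]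
  congr 1
  · change Matrix.det _ = Matrix.det _
    congr 1
    ext p i
    simp only [exchangeLeft, Matrix.of_apply]
    split_ifs <;> rfl
  · change Matrix.det _ = Matrix.det _
    congr 1
    ext p i
    simp only [exchangeRight, Matrix.of_apply]
    split_ifs <;> rfl

theorem exchangeLeft_sumCongr (f g : Fin n → Fin N) (r : Fin n)
    (a : Equiv.Perm {p : Fin n // r ≤ p}) (b : Equiv.Perm {p : Fin n // p ≤ r}) :
    exchangeLeft f g r (Equiv.Perm.sumCongr a b) = f ∘ Equiv.Perm.ofSubtype a := by
  ext p
  by_cases h : r ≤ p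
  · simp [exchangeLeft, h, Equiv.Perm.ofSubtype_apply_of_mem a h]
  · simp [exchangeLeft, h, Equiv.Perm.ofSubtype_apply_of_not_mem a h]

theorem exchangeRight_sumCongr (f g : Fin n → Fin N) (r : Fin n)
    (a : Equiv.Perm {p : Fin n // r ≤ p}) (b : Equiv.Perm {p : Fin n // p ≤ r}) :
    exchangeRight f g r (Equiv.Perm.sumCongr a b) = g ∘ Equiv.Perm.ofSubtype b := by
  ext p
  by_cases h : p ≤ r
  · simp [exchangeRight, h, Equiv.Perm.ofSubtype_apply_of_mem b h]
  · simp [exchangeRight, h, Equiv.Perm.ofSubtype_apply_of_not_mem b h]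

theorem sign_smul_exchange_sumCongr (y : Fin N → Fin n → R) (f g : Fin n → Fin N) (r : Fin n)
    (a : Equiv.Perm {p : Fin n // r ≤ p}) (b : Equiv.Perm {p : Fin n // p ≤ r}) :
    (Equiv.Perm.sign (Equiv.Perm.sumCongr a b) : ℤ) •
      (maxMinor y (exchangeLeft f g r (Equiv.Perm.sumCongr a b)) *
        maxMinor y (exchangeRight f g r (Equiv.Perm.sumCongr a b))) =
      maxMinor y f * maxMinor y g := by
  rw [exchangeLeft_sumCongr, exchangeRight_sumCongr, maxMinor_comp_perm, maxMinor_comp_perm,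
    Equiv.Perm.sign_sumCongr, Equiv.Perm.sign_ofSubtype, Equiv.Perm.sign_ofSubtype]
  rcases Int.units_eq_one_or (Equiv.Perm.sign a) with ha | ha <;>
    rcases Int.units_eq_one_or (Equiv.Perm.sign b) with hb | hb <;> simp [ha, hb]

theorem sum_dite_subtype (P : Fin n → Prop) [DecidablePred P] (u : {p // P p} → ℤ)
    (w : Fin n → ℤ) :
    ∑ p, (if h : P p then u ⟨p, h⟩ else w p) =
      ∑ p : {p // P p}, u p + ∑ p : {p // ¬ P p}, w p := by
  rw [← Fintype.sum_subtype_add_sum_subtype P]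
  congr 1
  · exact Finset.sum_congr rfl fun p _ => by simp [p.2]
  · exact Finset.sum_congr rfl fun p _ => by simp [p.2]

theorem rowSum_exchangeLeft (f g : Fin n → Fin N) (r : Fin n) (σ : Equiv.Perm (ExchangePos r)) :
    (rowSum (exchangeLeft f g r σ) : ℤ) =
      ∑ p : {p : Fin n // r ≤ p},
        ((Sum.elim (fun q => f q.1) (fun q => g q.1) (σ (Sum.inl p)) : Fin N) : ℤ) +
      ∑ p : {p : Fin n // ¬ r ≤ p}, ((f p : Fin N) : ℤ) := by
  rw [← sum_dite_subtype (fun p => r ≤ p)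
    (fun p => ((Sum.elim (fun q => f q.1) (fun q => g q.1) (σ (Sum.inl p)) : Fin N) : ℤ))
    fun p => ((f p : Fin N) : ℤ)]
  simp only [rowSum, Nat.cast_sum]
  refine Finset.sum_congr rfl fun p _ => ?_
  simp only [exchangeLeft]
  split_ifs <;> rfl

theorem rowSum_exchangeRight (f g : Fin n → Fin N) (r : Fin n) (σ : Equiv.Perm (ExchangePos r)) :
    (rowSum (exchangeRight f g r σ) : ℤ) =
      ∑ p : {p : Fin n // p ≤ r},
        ((Sum.elim (fun q => f q.1) (fun q => g q.1) (σ (Sum.inr p)) : Fin N) : ℤ) +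
      ∑ p : {p : Fin n // ¬ p ≤ r}, ((g p : Fin N) : ℤ) := by
  rw [← sum_dite_subtype (fun p => p ≤ r)
    (fun p => ((Sum.elim (fun q => f q.1) (fun q => g q.1) (σ (Sum.inr p)) : Fin N) : ℤ))
    fun p => ((g p : Fin N) : ℤ)]
  simp only [rowSum, Nat.cast_sum]
  refine Finset.sum_congr rfl fun p _ => ?_
  simp only [exchangeRight]
  split_ifs <;> rfl

theorem exchangeLeft_one (f g : Fin n → Fin N) (r : Fin n) : exchangeLeft f g r 1 = f := by
  ext p; simp [exchangeLeft]

theorem exchangeRight_one (f g : Fin n → Fin N) (r : Fin n) : exchangeRight f g r 1 = g := by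
  ext p; simp [exchangeRight]

theorem rowSum_exchange_add (f g : Fin n → Fin N) (r : Fin n) (σ : Equiv.Perm (ExchangePos r)) :
    rowSum (exchangeLeft f g r σ) + rowSum (exchangeRight f g r σ) = rowSum f + rowSum g := by
  have hl := rowSum_exchangeLeft f g r σ
  have hr := rowSum_exchangeRight f g r σ
  have hl1 := rowSum_exchangeLeft f g r 1
  have hr1 := rowSum_exchangeRight f g r 1
  rw [exchangeLeft_one] at hl1
  rw [exchangeRight_one] at hr1
  have h := Equiv.sum_comp σ fun z =>
    ((Sum.elim (fun q => f q.1) (fun q => g q.1) z : Fin N) : ℤ)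
  rw [Fintype.sum_sum_type, Fintype.sum_sum_type] at h
  simp only [Equiv.Perm.one_apply] at hl1 hr1
  zify
  linarith

theorem sum_perm_inl_lt {α β : Type*} [Fintype α] [Fintype β] (c : α ⊕ β → ℤ) (T : ℤ)
    (hα : ∀ a, T ≤ c (Sum.inl a)) (hβ : ∀ b, c (Sum.inr b) < T) (σ : Equiv.Perm (α ⊕ β))
    {a : α} {b : β} (hab : σ (Sum.inl a) = Sum.inr b) :
    ∑ p, c (σ (Sum.inl p)) < ∑ p, c (Sum.inl p) := by
  have hσ : ∀ τ : Equiv.Perm (α ⊕ β), ∑ p, (c (τ (Sum.inl p)) - T) =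
      ∑ z, if (τ.symm z).isLeft then c z - T else 0 := fun τ => by
    rw [← Equiv.sum_comp τ, Fintype.sum_sum_type]
    simp
  have h : ∑ p, (c (σ (Sum.inl p)) - T) < ∑ p, (c (Sum.inl p) - T) := by
    rw [hσ σ]
    have h1 := hσ 1
    simp only [Equiv.Perm.one_apply] at h1
    rw [h1]
    refine Finset.sum_lt_sum (fun z _ => ?_) ⟨Sum.inr b, Finset.mem_univ _, ?_⟩
    · rcases z with z | z
      · have := hα z
        change _ ≤ if (Sum.inl z : α ⊕ β).isLeft then _ else _
        split_ifs <;> simp_all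
      · have := hβ z
        change _ ≤ if (Sum.inr z : α ⊕ β).isLeft then _ else _
        split_ifs <;> first | linarith | simp_all
    · have := hβ b
      have hb : σ.symm (Sum.inr b) = Sum.inl a := by rw [← hab, Equiv.symm_apply_apply]
      change _ < if (Sum.inr b : α ⊕ β).isLeft then _ else _
      simp [hb, this]
  simp only [Finset.sum_sub_distrib] at h
  linarith

theorem rowSum_exchangeLeft_lt {f g : Fin n → Fin N} (hf : Monotone f) (hg : Monotone g)
    {r : Fin n} (hr : g r < f r) {σ : Equiv.Perm (ExchangePos r)}
    {p : {p : Fin n // r ≤ p}} {q : {p : Fin n // p ≤ r}} (hσ : σ (Sum.inl p) = Sum.inr q) :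
    rowSum (exchangeLeft f g r σ) < rowSum f := by
  have hl := rowSum_exchangeLeft f g r σ
  have hl1 := rowSum_exchangeLeft f g r 1
  rw [exchangeLeft_one] at hl1
  have h := sum_perm_inl_lt (fun z =>
    ((Sum.elim (fun q => f q.1) (fun q => g q.1) z : Fin N) : ℤ)) (f r : ℕ)
    (fun a => by simpa using hf a.2)
    (fun b => by simpa using (hg b.2).trans_lt hr) σ hσ
  simp only [Equiv.Perm.one_apply] at hl1
  zify
  linarith

variable {𝕜 : Type*} [Field 𝕜] [CharZero 𝕜] [Algebra 𝕜 R]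

theorem mul_maxMinor_mem_span_exchange (y : Fin N → Fin n → R) {f g : Fin n → Fin N}
    (hf : Monotone f) (hg : Monotone g) {r : Fin n} (hr : g r < f r) :
    maxMinor y f * maxMinor y g ∈ Submodule.span 𝕜 {x | ∃ f' g' : Fin n → Fin N,
      rowSum f' < rowSum f ∧ rowSum f' + rowSum g' = rowSum f + rowSum g ∧
      x = maxMinor y f' * maxMinor y g'} := by
  classical
  set V := Submodule.span 𝕜 {x | ∃ f' g' : Fin n → Fin N,
      rowSum f' < rowSum f ∧ rowSum f' + rowSum g' = rowSum f + rowSum g ∧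
      x = maxMinor y f' * maxMinor y g'} with hV
  let S : Finset (Equiv.Perm (ExchangePos r)) := Finset.univ.filter fun σ =>
    Set.MapsTo σ (Set.range Sum.inl) (Set.range Sum.inl)
  have h0 := sum_exchange_eq_zero y f g r
  rw [← Finset.sum_filter_add_sum_filter_not _ fun σ : Equiv.Perm (ExchangePos r) =>
    Set.MapsTo σ (Set.range Sum.inl) (Set.range Sum.inl)] at h0
  have h1 : ∀ σ ∈ S, (Equiv.Perm.sign σ : ℤ) •
      (maxMinor y (exchangeLeft f g r σ) * maxMinor y (exchangeRight f g r σ)) =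
        maxMinor y f * maxMinor y g := fun σ hσ => by
    obtain ⟨⟨a, b⟩, rfl⟩ := Equiv.Perm.mem_sumCongrHom_range_of_perm_mapsTo_inl
      (Finset.mem_filter.1 hσ).2
    exact sign_smul_exchange_sumCongr y f g r a b
  rw [Finset.sum_congr rfl h1, Finset.sum_const, add_eq_zero_iff_eq_neg] at h0
  have hS : (S.card : 𝕜) ≠ 0 := by
    rw [Nat.cast_ne_zero]
    refine Finset.card_ne_zero_of_mem (a := 1) (Finset.mem_filter.2 ⟨Finset.mem_univ _, ?_⟩)
    intro z hz
    simpa using hz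
  have h2 : (S.card : 𝕜) • (maxMinor y f * maxMinor y g) ∈ V := by
    rw [Nat.cast_smul_eq_nsmul, h0]
    refine V.neg_mem (V.sum_mem fun σ hσ => ?_)
    rw [← Int.cast_smul_eq_zsmul 𝕜]
    refine V.smul_mem _ (Submodule.subset_span ⟨_, _, ?_, rowSum_exchange_add f g r σ, rfl⟩)
    have := (Finset.mem_filter.1 hσ).2
    simp only [Set.MapsTo, not_forall] at this
    obtain ⟨_, ⟨p, rfl⟩, hp⟩ := this
    rcases h : σ (Sum.inl p) with q | q
    · exact absurd ⟨q, h.symm⟩ hp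
    · exact rowSum_exchangeLeft_lt hf hg hr h
  exact (V.smul_mem_iff hS).1 h2

/-- Sorting the entries of every factor changes a product of maximal minors by a sign at most. -/
theorem exists_strictMono_list (y : Fin N → Fin n → R) (L : List (Fin n → Fin N))
    (hL : ∀ f ∈ L, Function.Injective f) :
    ∃ L' : List (Fin n → Fin N), (∀ f ∈ L', StrictMono f) ∧
      L'.map rowSum = L.map rowSum ∧
      ∃ ε : ℤ, (L.map (maxMinor y)).prod = ε • (L'.map (maxMinor y)).prod := by
  induction L with
  | nil => exact ⟨[], by simp, by simp, 1, by simp⟩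
  | cons f L ih =>
    obtain ⟨L', h1, h2, ε, h3⟩ := ih fun g hg => hL g (List.mem_cons_of_mem _ hg)
    refine ⟨(f ∘ Tuple.sort f) :: L', ?_, ?_,
      (Equiv.Perm.sign (Tuple.sort f) : ℤ) * ε, ?_⟩
    · intro g hg
      rcases List.mem_cons.1 hg with rfl | hg
      · exact (Tuple.monotone_sort f).strictMono_of_injective
          ((hL f List.mem_cons_self).comp (Tuple.sort f).injective)
      · exact h1 g hg
    · simp [h2, rowSum_comp_perm]
    · simp only [List.map_cons, List.prod_cons, h3, maxMinor_comp_perm]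
      rcases Int.units_eq_one_or (Equiv.Perm.sign (Tuple.sort f)) with ha | ha <;>
        simp [ha] <;> ring

theorem prod_maxMinor_mem_span_standard (y : Fin N → Fin n → R) (L : List (Fin n → Fin N)) :
    (L.map (maxMinor y)).prod ∈ Submodule.span 𝕜 {x | ∃ L' : List (Fin n → Fin N),
      (∀ f ∈ L', StrictMono f) ∧ L'.Pairwise (· ≤ ·) ∧ x = (L'.map (maxMinor y)).prod} := by
  set V := Submodule.span 𝕜 {x | ∃ L' : List (Fin n → Fin N),
      (∀ f ∈ L', StrictMono f) ∧ L'.Pairwise (· ≤ ·) ∧ x = (L'.map (maxMinor y)).prod} with hV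
  have hbound : ∀ L : List (Fin n → Fin N),
      (L.map fun f => rowSum f ^ 2).sum ≤ L.length * (n * N) ^ 2 := fun L => by
    refine (List.sum_le_card_nsmul _ ((n * N) ^ 2) ?_).trans (by simp)
    simp only [List.mem_map]
    rintro _ ⟨f, -, rfl⟩
    exact Nat.pow_le_pow_left (rowSum_le f) 2
  induction hk : L.length * (n * N) ^ 2 - (L.map fun f => rowSum f ^ 2).sum
    using Nat.strong_induction_on generalizing L with
  | _ k ih =>
  by_cases hinj : ∀ f ∈ L, Function.Injective f
  swap
  · push Not at hinj
    obtain ⟨f, hf, hfi⟩ := hinj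
    rw [List.prod_eq_zero (List.mem_map.2 ⟨f, hf, maxMinor_eq_zero_of_not_injective y hfi⟩)]
    exact V.zero_mem
  obtain ⟨L₁, hmono, hsum, ε, hε⟩ := exists_strictMono_list y L hinj
  rw [hε, ← Int.cast_smul_eq_zsmul 𝕜]
  refine V.smul_mem _ ?_
  let L₂ := L₁.insertionSort fun f g => rowSum f ≤ rowSum g
  have : Std.Total fun f g : Fin n → Fin N => rowSum f ≤ rowSum g :=
    ⟨fun f g => le_total _ _⟩
  have : IsTrans (Fin n → Fin N) fun f g => rowSum f ≤ rowSum g :=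
    ⟨fun _ _ _ => le_trans⟩
  have hsort : L₂.Pairwise fun f g => rowSum f ≤ rowSum g := List.pairwise_insertionSort _ L₁
  have hperm : L₂.Perm L₁ := List.perm_insertionSort _ L₁
  rw [← (hperm.map (maxMinor y)).prod_eq]
  have hmono₂ : ∀ f ∈ L₂, StrictMono f := fun f hf => hmono f (hperm.mem_iff.1 hf)
  have hlen : L₂.length = L.length := by
    rw [hperm.length_eq, ← List.length_map (f := rowSum), hsum, List.length_map]
  have hsq : (L₂.map fun f => rowSum f ^ 2).sum = (L.map fun f => rowSum f ^ 2).sum := by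
    rw [(hperm.map _).sum_eq]
    have h : ∀ M : List (Fin n → Fin N),
        (M.map fun f => rowSum f ^ 2) = (M.map rowSum).map (· ^ 2) := fun M => by simp
    rw [h, h, hsum]
  by_cases hst : L₂.Pairwise (· ≤ ·)
  · exact Submodule.subset_span ⟨L₂, hmono₂, hst, rfl⟩
  rw [List.pairwise_iff_forall_sublist] at hst
  push Not at hst
  obtain ⟨f, g, hfg, hnle⟩ := hst
  obtain ⟨r, hr⟩ : ∃ r, g r < f r := by
    simpa [Pi.le_def] using hnle
  have hle : rowSum f ≤ rowSum g := List.pairwise_iff_forall_sublist.1 hsort hfg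
  obtain ⟨M, hM⟩ := hfg.exists_perm_append
  rw [(hM.map (maxMinor y)).prod_eq]
  have hf := hmono₂ f (hfg.subset (by simp))
  have hg := hmono₂ g (hfg.subset (by simp))
  have hmem := mul_maxMinor_mem_span_exchange (𝕜 := 𝕜) y hf.monotone hg.monotone hr
  have hlenM := hM.length_eq
  have hsqM := (hM.map fun f => rowSum f ^ 2).sum_eq
  simp only [List.cons_append, List.nil_append, List.length_cons, List.map_cons,
    List.sum_cons, List.prod_cons] at hlenM hsqM ⊢
  rw [← mul_assoc]
  refine Submodule.span_induction
    (p := fun x _ => x * (M.map (maxMinor y)).prod ∈ V) ?_ ?_ ?_ ?_ hmem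
  · rintro _ ⟨f', g', hlt, hadd, rfl⟩
    have hb := hbound (f' :: g' :: M)
    have hgt : rowSum f ^ 2 + rowSum g ^ 2 < rowSum f' ^ 2 + rowSum g' ^ 2 := by
      zify at hlt hadd hle ⊢
      nlinarith
    have := ih _ (by
      simp only [List.length_cons, List.map_cons, List.sum_cons] at hb ⊢
      rw [← hk, ← hlen, hlenM, ← hsq, hsqM]
      omega) (f' :: g' :: M) rfl
    simpa [mul_assoc] using this
  · simp
  · intro a b _ _ ha hb
    rw [add_mul]
    exact V.add_mem ha hb
  · intro c a _ ha
    rw [smul_mul_assoc]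
    exact V.smul_mem _ ha

end Straightening

section Dictionary

/-- The rows of the matrix obtained by stacking the transpose of the generic `n × m` matrix on top
of the reversed identity matrix of size `n`. -/
def stackedRow (n m : ℕ) (c : Fin (m + n)) (i : Fin n) : MvPolynomial (Fin n × Fin m) ℂ :=
  Fin.addCases (fun j => MvPolynomial.X (i, j)) (fun k => if i = k.rev then 1 else 0) c

theorem stackedRow_castAdd {n m : ℕ} (j : Fin m) (i : Fin n) :
    stackedRow n m (Fin.castAdd n j) i = MvPolynomial.X (i, j) := by
  simp [stackedRow]

theorem stackedRow_natAdd {n m : ℕ} (k : Fin n) (i : Fin n) :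
    stackedRow n m (Fin.natAdd m k) i = if i = k.rev then 1 else 0 := by
  simp [stackedRow]

/-- The strictly increasing row selections `K` of the stacked matrix that correspond to the
one-line tableau with rows `a` and columns `b`. -/
structure SelectsMinor {n m l : ℕ} (K : Fin n → Fin (m + n)) (a : Fin l → Fin n)
    (b : Fin l → Fin m) : Prop where
  le : l ≤ n
  left_mono : StrictMono a
  right_mono : StrictMono b
  right_eq : ∀ p, Fin.castAdd n (b p) = K (Fin.castLE le p)
  lt_iff : ∀ p, (K p : ℕ) < m ↔ (p : ℕ) < l
  mem_range_iff : ∀ i, i ∈ Set.range a ↔ Fin.natAdd m i.rev ∉ Set.range K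

theorem StrictMono.exists_lt_iff {n N : ℕ} {K : Fin n → Fin N} (hK : StrictMono K) (m : ℕ) :
    ∃ l ≤ n, ∀ p, (K p : ℕ) < m ↔ (p : ℕ) < l := by
  induction n with
  | zero => exact ⟨0, le_rfl, fun p => p.elim0⟩
  | succ n ih =>
    by_cases h : (K (Fin.last n) : ℕ) < m
    · refine ⟨n + 1, le_rfl, fun p => ⟨fun _ => p.2, fun _ => lt_of_le_of_lt ?_ h⟩⟩
      exact hK.monotone (Fin.le_last p)
    · obtain ⟨l, hl, h'⟩ := ih (K := K ∘ Fin.castSucc) (hK.comp Fin.strictMono_castSucc)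
      refine ⟨l, hl.trans n.le_succ, fun p => ?_⟩
      refine Fin.lastCases ?_ (fun p => h' p) p
      simp only [h, Fin.val_last, false_iff]
      omega

theorem exists_selectsMinor {n m : ℕ} {K : Fin n → Fin (m + n)} (hK : StrictMono K) :
    ∃ (l : ℕ) (a : Fin l → Fin n) (b : Fin l → Fin m), SelectsMinor K a b := by
  classical
  obtain ⟨l, hl, hlt⟩ := hK.exists_lt_iff m
  let S : Finset (Fin n) := Finset.univ.filter fun i => Fin.natAdd m i.rev ∉ Set.range K
  have hS : S.card = l := by
    have h1 : (Finset.univ.filter fun p : Fin n => ¬ (p : ℕ) < l).card = n - l := by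
      have := Finset.card_filter_add_card_filter_not (s := (Finset.univ : Finset (Fin n)))
        (fun p : Fin n => (p : ℕ) < l)
      have h2 : (Finset.univ.filter fun p : Fin n => (p : ℕ) < l).card = l := by
        rw [Fin.card_filter_val_lt, min_eq_right hl]
      simp only [Finset.card_univ, Fintype.card_fin] at this
      omega
    have h2 : (Finset.univ.filter fun i : Fin n => ¬ Fin.natAdd m i.rev ∉ Set.range K).card =
        (Finset.univ.filter fun p : Fin n => ¬ (p : ℕ) < l).card := by
      symm
      refine Finset.card_bij (fun p hp => (Fin.subNat m ((K p).cast (Nat.add_comm m n))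
        (by simpa [← hlt] using hp)).rev) ?_ ?_ ?_
      · intro p hp
        simp only [Finset.mem_filter, Finset.mem_univ, true_and, not_not]
        refine ⟨p, ?_⟩
        have : m ≤ (K p : ℕ) := by simpa [← hlt] using hp
        ext
        simp
      · intro p hp q hq h
        have h1 : m ≤ (K p : ℕ) := by simpa [← hlt] using hp
        have h2 : m ≤ (K q : ℕ) := by simpa [← hlt] using hq
        rw [Fin.rev_inj, Fin.ext_iff] at h
        simp at h
        exact hK.injective (Fin.ext (by omega))
      · intro i hi
        simp only [Finset.mem_filter, Finset.mem_univ, true_and, not_not] at hi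
        obtain ⟨p, hp⟩ := hi
        refine ⟨p, ?_, ?_⟩
        · simp [← hlt, hp]
        · ext
          simp [hp]
    have h3 := Finset.card_filter_add_card_filter_not (s := (Finset.univ : Finset (Fin n)))
      (fun i => Fin.natAdd m i.rev ∉ Set.range K)
    simp only [Finset.card_univ, Fintype.card_fin] at h3
    change S.card + _ = n at h3
    omega
  refine ⟨l, S.orderEmbOfFin hS, fun p => (K (Fin.castLE hl p)).castLT ((hlt _).2 p.2), hl,
    (S.orderEmbOfFin hS).strictMono, fun p q h => hK h, fun p => ?_, hlt, fun i => ?_⟩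
  · ext; simp
  · rw [Finset.range_orderEmbOfFin]
    simp [S]

theorem SelectsMinor.maxMinor_eq {n m l : ℕ} {K : Fin n → Fin (m + n)} {a : Fin l → Fin n}
    {b : Fin l → Fin m} (h : SelectsMinor K a b) :
    ∃ ε : ℤ, maxMinor (stackedRow n m) K =
      ε • Matrix.det (Matrix.of fun p q => MvPolynomial.X (R := ℂ) (a p, b q)) := by
  classical
  let e : Fin l ⊕ {i // i ∉ Set.range a} ≃ Fin n :=
    ((Equiv.ofInjective a h.left_mono.injective).sumCongr (Equiv.refl _)).trans
      (Equiv.Set.sumCompl (Set.range a))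
  have hc : ∀ i : {i // i ∉ Set.range a}, ∃ p, K p = Fin.natAdd m i.1.rev := fun i => by
    have := i.2
    rw [h.mem_range_iff, not_not] at this
    exact this
  choose c hc using hc
  let f₀ : Fin l ⊕ {i // i ∉ Set.range a} → Fin n := Sum.elim (Fin.castLE h.le) c
  have hcl : ∀ i, l ≤ (c i : ℕ) := fun i => by
    rw [← not_lt, ← h.lt_iff, hc]
    simp
  have hinj : Function.Injective f₀ := by
    rintro (p | i) (q | j) hpq
    · simpa [f₀] using hpq
    · have := hcl j
      simp only [f₀, Sum.elim_inl, Sum.elim_inr] at hpq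
      rw [← hpq] at this
      have := p.2
      simp at *
      omega
    · have := hcl i
      simp only [f₀, Sum.elim_inl, Sum.elim_inr] at hpq
      rw [hpq] at this
      have := q.2
      simp at *
      omega
    · simp only [f₀, Sum.elim_inr] at hpq
      have h1 := hc i
      rw [hpq, hc] at h1
      have h2 := Fin.rev_injective (Fin.natAdd_injective _ _ h1)
      rw [Subtype.ext h2]
  let f : Fin l ⊕ {i // i ∉ Set.range a} ≃ Fin n := Equiv.ofBijective f₀
    ((Fintype.bijective_iff_injective_and_card f₀).2 ⟨hinj, Fintype.card_congr e⟩)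
  let M : Matrix (Fin n) (Fin n) (MvPolynomial (Fin n × Fin m) ℂ) :=
    Matrix.of fun p => stackedRow n m (K p)
  have he₁ : ∀ q, e (Sum.inl q) = a q := fun q => rfl
  have he₂ : ∀ i, e (Sum.inr i) = i.1 := fun i => rfl
  have hblock : M.submatrix f e = Matrix.fromBlocks
      (Matrix.of fun p q => MvPolynomial.X (R := ℂ) (a p, b q)).transpose
      (Matrix.of fun p i => M (f (Sum.inl p)) (e (Sum.inr i))) 0 1 := by
    ext1 (p | i) (q | j)
    · simp [M, f, he₁, he₂, f₀, ← h.right_eq, stackedRow_castAdd]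
    · simp
    · have : a q ≠ i := fun hq => i.2 ⟨q, hq⟩
      simp [M, f, he₁, he₂, f₀, hc, stackedRow_natAdd, this]
    · simp [M, f, he₂, f₀, hc, stackedRow_natAdd, Matrix.one_apply, Subtype.ext_iff, eq_comm]
  have hdet : (M.submatrix f e).det =
      Matrix.det (Matrix.of fun p q => MvPolynomial.X (R := ℂ) (a p, b q)) := by
    rw [hblock, Matrix.det_fromBlocks_zero₂₁, Matrix.det_one, mul_one, Matrix.det_transpose]
  have hdet2 : (M.submatrix f e).det = (Equiv.Perm.sign (e.symm.trans f) : ℤ) * M.det := by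
    rw [← Matrix.det_permute, ← Matrix.det_submatrix_equiv_self e]
    congr 1
    ext p q
    simp
  refine ⟨Equiv.Perm.sign (e.symm.trans f), ?_⟩
  rw [← hdet, hdet2]
  change M.det = _
  rcases Int.units_eq_one_or (Equiv.Perm.sign (e.symm.trans f)) with hs | hs <;> simp [hs]

theorem SelectsMinor.length_le {n m l l' : ℕ} {K K' : Fin n → Fin (m + n)} {a : Fin l → Fin n}
    {b : Fin l → Fin m} {a' : Fin l' → Fin n} {b' : Fin l' → Fin m} (h : SelectsMinor K a b)
    (h' : SelectsMinor K' a' b') (hle : K ≤ K') : l' ≤ l := by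
  by_contra! hlt
  let p : Fin n := ⟨l, hlt.trans_le h'.le⟩
  have h1 := (h'.lt_iff p).2 hlt
  have h2 := (h.lt_iff p).1 (lt_of_le_of_lt (hle p) h1)
  exact lt_irrefl _ h2

theorem SelectsMinor.right_le {n m l l' : ℕ} {K K' : Fin n → Fin (m + n)} {a : Fin l → Fin n}
    {b : Fin l → Fin m} {a' : Fin l' → Fin n} {b' : Fin l' → Fin m} (h : SelectsMinor K a b)
    (h' : SelectsMinor K' a' b') (hle : K ≤ K') (r : Fin l') :
    b (Fin.castLE (h.length_le h' hle) r) ≤ b' r := by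
  have h1 := hle (Fin.castLE h'.le r)
  have h2 := h.right_eq (Fin.castLE (h.length_le h' hle) r)
  have h3 := h'.right_eq r
  rw [Fin.le_def] at h1 ⊢
  rw [Fin.ext_iff] at h2 h3
  simp only [Fin.castLE_castLE, Fin.val_castAdd] at h1 h2 h3
  omega

theorem SelectsMinor.left_le {n m l l' : ℕ} {K K' : Fin n → Fin (m + n)} {a : Fin l → Fin n}
    {b : Fin l → Fin m} {a' : Fin l' → Fin n} {b' : Fin l' → Fin m} (h : SelectsMinor K a b)
    (h' : SelectsMinor K' a' b') (hK : StrictMono K) (hK' : StrictMono K') (hle : K ≤ K')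
    (r : Fin l') : a (Fin.castLE (h.length_le h' hle) r) ≤ a' r := by
  classical
  by_contra! hlt
  set x := a' r with hx
  -- rows up to `x` are counted by the two selections
  have hcount : ∀ {l : ℕ} {K : Fin n → Fin (m + n)} {a : Fin l → Fin n} {b : Fin l → Fin m},
      SelectsMinor K a b → StrictMono K →
      (Finset.univ.filter fun q => a q ≤ x).card +
        (Finset.univ.filter fun p => Fin.natAdd m x.rev ≤ K p).card = x + 1 := by
    intro l K a b h hK
    have h1 : (Finset.univ.filter fun q => a q ≤ x).card =
        ((Finset.Iic x).filter fun i => i ∈ Set.range a).card := by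
      refine Finset.card_bij (fun q _ => a q) ?_ ?_ ?_
      · simp
      · intro p _ q _ hpq
        exact h.left_mono.injective hpq
      · simp only [Finset.mem_filter, Finset.mem_Iic]
        rintro _ ⟨hi, q, rfl⟩
        exact ⟨q, by simpa using hi, rfl⟩
    have h2 : (Finset.univ.filter fun p => Fin.natAdd m x.rev ≤ K p).card =
        ((Finset.Iic x).filter fun i => ¬ i ∈ Set.range a).card := by
      symm
      have hc : ∀ i, ¬ i ∈ Set.range a → ∃ p, K p = Fin.natAdd m i.rev := fun i hi => by
        rw [h.mem_range_iff, not_not] at hi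
        exact hi
      choose c hc using hc
      refine Finset.card_bij (fun i hi => c i (Finset.mem_filter.1 hi).2) ?_ ?_ ?_
      · intro i hi
        have := (Finset.mem_filter.1 hi).1
        simpa [hc, Fin.rev_le_rev] using this
      · intro i hi j hj hij
        have h1 := hc i (Finset.mem_filter.1 hi).2
        rw [hij, hc] at h1
        exact (Fin.rev_injective (Fin.natAdd_injective _ _ h1)).symm
      · intro p hp
        have hp' : Fin.natAdd m x.rev ≤ K p := (Finset.mem_filter.1 hp).2
        have hm : m ≤ (K p : ℕ) := le_trans (by simp) (Fin.le_def.1 hp')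
        let i : Fin n := (Fin.subNat m ((K p).cast (Nat.add_comm m n)) hm).rev
        have hi : Fin.natAdd m i.rev = K p := by
          ext
          simp [i]
        have hir : i ∉ Set.range a := by
          rw [h.mem_range_iff, not_not, hi]
          exact ⟨p, rfl⟩
        refine ⟨i, ?_, hK.injective (by rw [hc, hi])⟩
        rw [← hi] at hp'
        simp only [Finset.mem_filter, Finset.mem_Iic]
        exact ⟨by simpa [Fin.rev_le_rev] using hp', hir⟩
    rw [h1, h2, Finset.card_filter_add_card_filter_not]
    simp
  have hk := hcount h hK
  have hk' := hcount h' hK'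
  have h1 : (Finset.univ.filter fun p => Fin.natAdd m x.rev ≤ K p).card ≤
      (Finset.univ.filter fun p => Fin.natAdd m x.rev ≤ K' p).card :=
    Finset.card_le_card fun p hp => by
      simp only [Finset.mem_filter, Finset.mem_univ, true_and] at hp ⊢
      exact hp.trans (hle p)
  have h2 : (Finset.univ.filter fun q => a q ≤ x).card ≤ r := by
    have : (Finset.univ.filter fun q => a q ≤ x) ⊆
        Finset.Iio (Fin.castLE (h.length_le h' hle) r) := fun q hq => by
      simp only [Finset.mem_filter, Finset.mem_univ, true_and, Finset.mem_Iio] at hq ⊢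
      exact h.left_mono.lt_iff_lt.1 (hq.trans_lt hlt)
    simpa using Finset.card_le_card this
  have h3 : (r : ℕ) + 1 ≤ (Finset.univ.filter fun q => a' q ≤ x).card := by
    have : Finset.Iic r ⊆ (Finset.univ.filter fun q => a' q ≤ x) := fun q hq => by
      simp only [Finset.mem_filter, Finset.mem_univ, true_and, Finset.mem_Iic] at hq ⊢
      exact h'.left_mono.monotone hq
    simpa using Finset.card_le_card this
  omega

/-- The `1`-based list of the values of a function on `Fin l`. -/
def oneBased {l k : ℕ} (a : Fin l → Fin k) : List ℕ := List.ofFn fun p => (a p : ℕ) + 1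

theorem oneBased_getD {l k : ℕ} (a : Fin l → Fin k) (p : Fin l) :
    (oneBased a).getD p 0 = a p + 1 := by
  simp [oneBased, List.getD_eq_getElem?_getD]

theorem length_oneBased {l k : ℕ} (a : Fin l → Fin k) : (oneBased a).length = l := by
  simp [oneBased]

theorem isChain_oneBased {l k : ℕ} {a : Fin l → Fin k} (ha : StrictMono a) :
    (oneBased a).IsChain (· < ·) := by
  rw [List.isChain_iff_pairwise, oneBased, List.pairwise_ofFn]
  intro i j hij
  have := ha hij
  rw [Fin.lt_def] at this
  omega

theorem isTab_oneBased {n m l : ℕ} (hl : l ≠ 0) {a : Fin l → Fin n} {b : Fin l → Fin m}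
    (ha : StrictMono a) (hb : StrictMono b) : isTab n m (oneBased a) (oneBased b) := by
  refine ⟨by simp [length_oneBased], ?_, isChain_oneBased ha, isChain_oneBased hb, ?_, ?_⟩
  · rw [ne_eq, ← List.length_eq_zero_iff, length_oneBased]
    exact hl
  · intro x hx
    obtain ⟨p, rfl⟩ := List.mem_ofFn.1 hx
    have := (a p).2
    omega
  · intro x hx
    obtain ⟨p, rfl⟩ := List.mem_ofFn.1 hx
    have := (b p).2
    omega

theorem dmin_oneBased {n m l : ℕ} (a : Fin l → Fin n) (b : Fin l → Fin m) :
    dmin n m (oneBased a) (oneBased b) =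
      Matrix.det (Matrix.of fun p q => MvPolynomial.X (R := ℂ) (a p, b q)) := by
  rw [dmin, ← Matrix.det_submatrix_equiv_self (finCongr (length_oneBased a).symm)]
  congr 1
  ext1 p q
  simp only [Matrix.submatrix_apply, Matrix.of_apply, finCongr_apply, Fin.val_cast,
    oneBased_getD, Nat.add_sub_cancel]
  rw [dif_pos ⟨(a p).2, (b q).2⟩]

theorem tleq_oneBased {n m l l' : ℕ} {K K' : Fin n → Fin (m + n)} {a : Fin l → Fin n}
    {b : Fin l → Fin m} {a' : Fin l' → Fin n} {b' : Fin l' → Fin m} (h : SelectsMinor K a b)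
    (h' : SelectsMinor K' a' b') (hK : StrictMono K) (hK' : StrictMono K') (hle : K ≤ K') :
    tleq (oneBased a, oneBased b) (oneBased a', oneBased b') := by
  refine ⟨by simpa [length_oneBased] using h.length_le h' hle, fun r hr => ?_⟩
  simp only [length_oneBased] at hr
  have h1 := oneBased_getD a' ⟨r, hr⟩
  have h2 := oneBased_getD b' ⟨r, hr⟩
  have h3 := oneBased_getD a (Fin.castLE (h.length_le h' hle) ⟨r, hr⟩)
  have h4 := oneBased_getD b (Fin.castLE (h.length_le h' hle) ⟨r, hr⟩)
  have h5 := h.left_le h' hK hK' hle ⟨r, hr⟩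
  have h6 := h.right_le h' hle ⟨r, hr⟩
  rw [Fin.le_def] at h5 h6
  simp only [Fin.val_castLE] at h1 h2 h3 h4
  simp only [h1, h2, h3, h4]
  omega

theorem tleq_trans {A B C : List ℕ × List ℕ} (h : tleq A B) (h' : tleq B C) : tleq A C :=
  ⟨h'.1.trans h.1, fun r hr => ⟨(h.2 r (hr.trans_le h'.1)).1.trans (h'.2 r hr).1,
    (h.2 r (hr.trans_le h'.1)).2.trans (h'.2 r hr).2⟩⟩

instance : IsTrans (List ℕ × List ℕ) tleq := ⟨fun _ _ _ => tleq_trans⟩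

/-- A product of maximal minors of the stacked matrix along a chain is a standard monomial up to
sign. -/
theorem exists_standard_of_chain {n m : ℕ} (L : List (Fin n → Fin (m + n)))
    (hL : ∀ K ∈ L, StrictMono K) (hc : L.Pairwise (· ≤ ·)) :
    ∃ T : List (List ℕ × List ℕ), (∀ t ∈ T, isTab n m t.1 t.2) ∧ T.Pairwise tleq ∧
      (∀ t ∈ T, ∃ K ∈ L, ∃ (l : ℕ) (a : Fin l → Fin n) (b : Fin l → Fin m),
        SelectsMinor K a b ∧ t = (oneBased a, oneBased b)) ∧
      ∃ ε : ℤ, (L.map (maxMinor (stackedRow n m))).prod =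
        ε • (T.map fun t => dmin n m t.1 t.2).prod := by
  induction L with
  | nil => exact ⟨[], by simp, by simp, by simp, 1, by simp⟩
  | cons K L ih =>
    rw [List.pairwise_cons] at hc
    obtain ⟨T, h1, h2, h3, ε, h4⟩ := ih (fun K hK => hL K (List.mem_cons_of_mem _ hK)) hc.2
    have hK := hL K List.mem_cons_self
    obtain ⟨l, a, b, h⟩ := exists_selectsMinor hK
    obtain ⟨η, hη⟩ := h.maxMinor_eq
    by_cases hl : l = 0
    · subst hl
      refine ⟨T, h1, h2, fun t ht => ?_, η * ε, ?_⟩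
      · obtain ⟨K', hK', h'⟩ := h3 t ht
        exact ⟨K', List.mem_cons_of_mem _ hK', h'⟩
      · rw [Matrix.det_isEmpty] at hη
        rw [List.map_cons, List.prod_cons, h4, hη, smul_mul_smul_comm, one_mul]
    · refine ⟨(oneBased a, oneBased b) :: T, ?_, ?_, ?_, η * ε, ?_⟩
      · simpa using ⟨isTab_oneBased hl h.left_mono h.right_mono, by simpa using h1⟩
      · refine List.pairwise_cons.2 ⟨fun t ht => ?_, h2⟩
        obtain ⟨K', hK', l', a', b', h', rfl⟩ := h3 t ht
        exact tleq_oneBased h h' hK (hL K' (List.mem_cons_of_mem _ hK')) (hc.1 K' hK')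
      · intro t ht
        rcases List.mem_cons.1 ht with rfl | ht
        · exact ⟨K, List.mem_cons_self, l, a, b, h, rfl⟩
        · obtain ⟨K', hK', h'⟩ := h3 t ht
          exact ⟨K', List.mem_cons_of_mem _ hK', h'⟩
      · rw [List.map_cons, List.prod_cons, h4, hη, smul_mul_smul_comm, List.map_cons,
          List.prod_cons, dmin_oneBased]

theorem X_mem_range_maxMinor {n m : ℕ} (i : Fin n) (j : Fin m) :
    MvPolynomial.X (R := ℂ) (i, j) ∈ Set.range (maxMinor (stackedRow n m)) := by
  refine ⟨fun p => if p = i then Fin.castAdd n j else Fin.natAdd m p.rev, ?_⟩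
  have h : (Matrix.of fun p => stackedRow n m
      (if p = i then Fin.castAdd n j else Fin.natAdd m p.rev)) =
      (1 : Matrix (Fin n) (Fin n) (MvPolynomial (Fin n × Fin m) ℂ)).updateRow i
        fun q => MvPolynomial.X (q, j) := by
    ext1 p q
    by_cases hp : p = i
    · subst hp
      simp [stackedRow_castAdd]
    · simp [hp, Matrix.updateRow_ne, stackedRow_natAdd, Matrix.one_apply, eq_comm (a := q)]
  rw [maxMinor, h, ← Matrix.cramer_transpose_apply, Matrix.transpose_one, Matrix.cramer_one]
  rfl

theorem span_standard_eq_top (n m : ℕ) :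
    Submodule.span ℂ {f : MvPolynomial (Fin n × Fin m) ℂ |
      ∃ L : List (List ℕ × List ℕ), (∀ t ∈ L, isTab n m t.1 t.2) ∧ L.IsChain tleq ∧
        f = (L.map fun t => dmin n m t.1 t.2).prod} = ⊤ := by
  set V := Submodule.span ℂ {f : MvPolynomial (Fin n × Fin m) ℂ |
      ∃ L : List (List ℕ × List ℕ), (∀ t ∈ L, isTab n m t.1 t.2) ∧ L.IsChain tleq ∧
        f = (L.map fun t => dmin n m t.1 t.2).prod} with hV
  have hadj : Algebra.adjoin ℂ (Set.range (maxMinor (stackedRow n m))) = ⊤ := by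
    rw [eq_top_iff, ← MvPolynomial.adjoin_range_X]
    refine Algebra.adjoin_mono ?_
    rintro _ ⟨⟨i, j⟩, rfl⟩
    exact X_mem_range_maxMinor i j
  rw [eq_top_iff, ← Algebra.top_toSubmodule, ← hadj, Algebra.adjoin_eq_span, Submodule.span_le]
  intro x hx
  obtain ⟨L, hL, rfl⟩ := Submonoid.exists_list_of_mem_closure hx
  obtain ⟨L, rfl⟩ : ∃ L' : List (Fin n → Fin (m + n)), L'.map (maxMinor (stackedRow n m)) = L :=
    (Set.range_list_map (maxMinor (stackedRow n m))).ge hL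
  refine Submodule.span_le.2 ?_ (prod_maxMinor_mem_span_standard (𝕜 := ℂ) (stackedRow n m) L)
  rintro _ ⟨L', hmono, hchain, rfl⟩
  obtain ⟨T, h1, h2, -, ε, h3⟩ := exists_standard_of_chain L' hmono hchain
  rw [h3, ← Int.cast_smul_eq_zsmul ℂ]
  exact V.smul_mem _ (Submodule.subset_span ⟨T, h1, List.isChain_iff_pairwise.2 h2, rfl⟩)

end Dictionary

section Independence

/-- A product of matrices is singular when the rows in `S` of the left factor are supported on
fewer than `#S` columns. -/
theorem det_mul_eq_zero_of_rows {A : Type*} [CommRing A] [IsDomain A] {l k : ℕ}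
    (P : Matrix (Fin l) (Fin k) A) (Q : Matrix (Fin k) (Fin l) A) (p : ℕ) (hp : p < l)
    (hP : ∀ (i : Fin l) (j : Fin k), (i : ℕ) ≤ p → p ≤ (j : ℕ) → P i j = 0) : (P * Q).det = 0 := by
  have hnot : ¬ LinearIndependent A fun (i : Fin (p + 1)) (j : Fin p) =>
      if h : (j : ℕ) < k then P ⟨i, by omega⟩ ⟨j, h⟩ else 0 := fun h => by
    have := h.fintype_card_le_finrank
    simp at this
  obtain ⟨g, hg, i₀, hi₀⟩ := Fintype.not_linearIndependent_iff.1 hnot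
  rw [← Matrix.exists_vecMul_eq_zero_iff]
  have hle : p + 1 ≤ l := hp
  let v : Fin l → A := fun i => if h : (i : ℕ) < p + 1 then g ⟨i, h⟩ else 0
  have hv : Matrix.vecMul v P = 0 := by
    ext j
    have hsum : Matrix.vecMul v P j = ∑ i : Fin (p + 1), g i * P (Fin.castLE hle i) j := by
      rw [Matrix.vecMul, dotProduct]
      symm
      refine Finset.sum_of_injOn (Fin.castLE hle) (Fin.castLE_injective hle).injOn (by simp) ?_ ?_
      · intro i _ hi
        have : ¬ (i : ℕ) < p + 1 := fun h => hi ⟨⟨i, h⟩, by simp, rfl⟩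
        simp only [v, dif_neg this, zero_mul]
      · intro i _
        simp only [v, Fin.val_castLE, dif_pos i.2]
    rw [hsum, Pi.zero_apply]
    by_cases hj : (j : ℕ) < p
    · have := congrFun hg ⟨j, hj⟩
      simp only [Finset.sum_apply, Pi.smul_apply, smul_eq_mul, Pi.zero_apply] at this
      rw [← this]
      refine Finset.sum_congr rfl fun i _ => ?_
      rw [dif_pos j.2]
      rfl
    · refine Finset.sum_eq_zero fun i _ => ?_
      rw [hP _ _ (Nat.lt_succ_iff.1 i.2) (not_lt.1 hj), mul_zero]
  refine ⟨v, fun h => hi₀ ?_, by rw [← Matrix.vecMul_vecMul, hv, Matrix.zero_vecMul]⟩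
  have := congrFun h (Fin.castLE hle i₀)
  simp only [v, Fin.val_castLE, dif_pos i₀.2] at this
  exact this

/-- The coordinates of a pair of an `n × n` and an `n × m` matrix. -/
abbrev FactorRing (n m : ℕ) := MvPolynomial (Fin n × Fin n ⊕ Fin n × Fin m) ℂ

/-- The map sending the generic `n × m` matrix to the product of generic `n × n` and `n × m`
matrices. -/
def factorMap (n m : ℕ) : MvPolynomial (Fin n × Fin m) ℂ →ₐ[ℂ] FactorRing n m :=
  MvPolynomial.aeval fun x =>
    ∑ k, MvPolynomial.X (Sum.inl (x.1, k)) * MvPolynomial.X (Sum.inr (k, x.2))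

/-- The restriction to the factorizations attached to the one-line tableau `t`: the columns of the
left factor and the rows of the right factor with index `k` start at the `k`-th entries of `t`. -/
def restrictTo (n m : ℕ) (t : List ℕ × List ℕ) : FactorRing n m →ₐ[ℂ] FactorRing n m :=
  MvPolynomial.aeval (Sum.elim
    (fun x => if (x.2 : ℕ) < t.1.length ∧ t.1.getD x.2 0 ≤ x.1 + 1 then
      MvPolynomial.X (Sum.inl x) else 0)
    (fun x => if (x.1 : ℕ) < t.1.length ∧ t.2.getD x.1 0 ≤ x.2 + 1 then
      MvPolynomial.X (Sum.inr x) else 0))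

theorem restrictTo_comp {n m : ℕ} {t t' : List ℕ × List ℕ} (h : tleq t t') :
    (restrictTo n m t').comp (restrictTo n m t) = restrictTo n m t' := by
  refine MvPolynomial.algHom_ext fun x => ?_
  rcases x with ⟨i, k⟩ | ⟨k, j⟩
  · simp only [AlgHom.comp_apply, restrictTo, MvPolynomial.aeval_X, Sum.elim_inl]
    by_cases hc : (k : ℕ) < t'.1.length ∧ t'.1.getD k 0 ≤ i + 1
    · have h1 := (h.2 k hc.1).1
      rw [if_pos ⟨hc.1.trans_le h.1, h1.trans hc.2⟩, MvPolynomial.aeval_X, Sum.elim_inl]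
    · rw [if_neg hc]
      split_ifs
      · rw [MvPolynomial.aeval_X, Sum.elim_inl, if_neg hc]
      · exact map_zero _
  · simp only [AlgHom.comp_apply, restrictTo, MvPolynomial.aeval_X, Sum.elim_inr]
    by_cases hc : (k : ℕ) < t'.1.length ∧ t'.2.getD k 0 ≤ j + 1
    · have h1 := (h.2 k hc.1).2
      rw [if_pos ⟨hc.1.trans_le h.1, h1.trans hc.2⟩, MvPolynomial.aeval_X, Sum.elim_inr]
    · rw [if_neg hc]
      split_ifs
      · rw [MvPolynomial.aeval_X, Sum.elim_inr, if_neg hc]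
      · exact map_zero _

theorem isTab.bounds {n m : ℕ} {I J : List ℕ} (h : isTab n m I J) {a : ℕ} (ha : a < I.length) :
    1 ≤ I.getD a 0 ∧ I.getD a 0 ≤ n ∧ 1 ≤ J.getD a 0 ∧ J.getD a 0 ≤ m := by
  obtain ⟨hl, -, -, -, hI, hJ⟩ := h
  rw [List.getD_eq_getElem _ _ ha, List.getD_eq_getElem _ _ (hl ▸ ha)]
  exact ⟨(hI _ (List.getElem_mem _)).1, (hI _ (List.getElem_mem _)).2,
    (hJ _ (List.getElem_mem _)).1, (hJ _ (List.getElem_mem _)).2⟩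

theorem List.IsChain.getD_lt {I : List ℕ} (h : I.IsChain (· < ·)) {a b : ℕ} (hab : a < b)
    (hb : b < I.length) : I.getD a 0 < I.getD b 0 := by
  rw [List.getD_eq_getElem _ _ (hab.trans hb), List.getD_eq_getElem _ _ hb]
  exact List.pairwise_iff_getElem.1 (List.isChain_iff_pairwise.1 h) _ _ _ _ hab

theorem List.IsChain.getD_mono {I : List ℕ} (h : I.IsChain (· < ·)) {a b : ℕ} (hab : a ≤ b)
    (hb : b < I.length) : I.getD a 0 ≤ I.getD b 0 := by
  rcases hab.eq_or_lt with rfl | hab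
  · exact le_rfl
  · exact (h.getD_lt hab hb).le

theorem map_dmin {n m : ℕ} {I J : List ℕ} (h : isTab n m I J) {A : Type*} [CommRing A]
    [Algebra ℂ A] (φ : MvPolynomial (Fin n × Fin m) ℂ →ₐ[ℂ] A) :
    φ (dmin n m I J) = Matrix.det (Matrix.of fun a b : Fin I.length =>
      φ (MvPolynomial.X
        (⟨I.getD a 0 - 1, by have := h.bounds a.2; omega⟩,
          ⟨J.getD b 0 - 1, by have := h.bounds b.2; omega⟩))) := by
  rw [dmin, AlgHom.map_det]
  congr 1
  ext1 a b
  have h1 := h.bounds a.2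
  have h2 := h.bounds b.2
  simp only [AlgHom.mapMatrix_apply, Matrix.map_apply, Matrix.of_apply]
  rw [dif_pos ⟨by omega, by omega⟩]

theorem restrictTo_factorMap_dmin_eq_zero {n m : ℕ} {s t : List ℕ × List ℕ}
    (hs : isTab n m s.1 s.2) (hlt : t.1.length = t.2.length) (ht : t.1.IsChain (· < ·))
    (ht' : t.2.IsChain (· < ·)) (hst : ¬ tleq t s) :
    restrictTo n m t (factorMap n m (dmin n m s.1 s.2)) = 0 := by
  obtain ⟨hl, -, hI, hJ, -⟩ := id hs
  let P : Matrix (Fin s.1.length) (Fin n) (FactorRing n m) := Matrix.of fun a k =>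
    if (k : ℕ) < t.1.length ∧ t.1.getD k 0 ≤ s.1.getD a 0 then MvPolynomial.X (Sum.inl
      (⟨s.1.getD a 0 - 1, by have := hs.bounds a.2; omega⟩, k)) else 0
  let Q : Matrix (Fin n) (Fin s.1.length) (FactorRing n m) := Matrix.of fun k b =>
    if (k : ℕ) < t.1.length ∧ t.2.getD k 0 ≤ s.2.getD b 0 then MvPolynomial.X (Sum.inr
      (k, ⟨s.2.getD b 0 - 1, by have := hs.bounds b.2; omega⟩)) else 0
  have hPQ : restrictTo n m t (factorMap n m (dmin n m s.1 s.2)) = (P * Q).det := by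
    have := map_dmin hs ((restrictTo n m t).comp (factorMap n m))
    rw [AlgHom.comp_apply] at this
    rw [this]
    congr 1
    ext1 a b
    have h1 := hs.bounds a.2
    have h2 := hs.bounds b.2
    simp only [Matrix.of_apply, AlgHom.comp_apply, factorMap, MvPolynomial.aeval_X, map_sum,
      map_mul, restrictTo, Sum.elim_inl, Sum.elim_inr, Matrix.mul_apply, P, Q,
      Nat.sub_add_cancel h1.1, Nat.sub_add_cancel h2.2.2.1]
  rw [hPQ]
  by_cases hlen : s.1.length ≤ t.1.length
  · have : ∃ r < s.1.length, s.1.getD r 0 < t.1.getD r 0 ∨ s.2.getD r 0 < t.2.getD r 0 := by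
      by_contra! hcon
      exact hst ⟨hlen, hcon⟩
    obtain ⟨r, hr, hrt | hrt⟩ := this
    · refine det_mul_eq_zero_of_rows P Q r hr fun i j hi hj => ?_
      simp only [P, Matrix.of_apply]
      refine if_neg fun hc => ?_
      have h1 := hI.getD_mono hi hr
      have h2 := ht.getD_mono hj hc.1
      omega
    · rw [← Matrix.det_transpose, Matrix.transpose_mul]
      refine det_mul_eq_zero_of_rows _ _ r hr fun i j hi hj => ?_
      simp only [Q, Matrix.transpose_apply, Matrix.of_apply]
      refine if_neg fun hc => ?_
      have h1 := hJ.getD_mono hi (hl ▸ hr)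
      have h2 := ht'.getD_mono hj (hlt ▸ hc.1)
      omega
  · refine det_mul_eq_zero_of_rows P Q t.1.length (by omega) fun i j _ hj => ?_
    simp only [P, Matrix.of_apply]
    rw [if_neg (by omega)]

theorem isTab.length_le {n m : ℕ} {I J : List ℕ} (h : isTab n m I J) : I.length ≤ n := by
  have hsub : I.toFinset ⊆ Finset.Icc 1 n := fun x hx => by
    simpa using h.2.2.2.2.1 x (by simpa using hx)
  have hnd : I.Nodup := (List.isChain_iff_pairwise.1 h.2.2.1).imp fun h => h.ne
  simpa [List.toFinset_card_of_nodup hnd] using Finset.card_le_card hsub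

theorem List.IsChain.getD_inj {I : List ℕ} (h : I.IsChain (· < ·)) {a b : ℕ}
    (ha : a < I.length) (hb : b < I.length) (hab : I.getD a 0 = I.getD b 0) : a = b := by
  rcases lt_trichotomy a b with hlt | rfl | hlt
  · exact absurd hab (h.getD_lt hlt hb).ne
  · rfl
  · exact absurd hab (h.getD_lt hlt ha).ne'

theorem restrictTo_factorMap_dmin_ne_zero {n m : ℕ} {t : List ℕ × List ℕ}
    (ht : isTab n m t.1 t.2) : restrictTo n m t (factorMap n m (dmin n m t.1 t.2)) ≠ 0 := by
  obtain ⟨hl, -, hI, hJ, -⟩ := id ht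
  let ev : FactorRing n m →ₐ[ℂ] ℂ := MvPolynomial.aeval (Sum.elim
    (fun x => if (x.2 : ℕ) < t.1.length ∧ t.1.getD x.2 0 = x.1 + 1 then 1 else 0)
    (fun x => if (x.1 : ℕ) < t.1.length ∧ t.2.getD x.1 0 = x.2 + 1 then 1 else 0))
  have hev : ev (restrictTo n m t (factorMap n m (dmin n m t.1 t.2))) = 1 := by
    have := map_dmin ht ((ev.comp (restrictTo n m t)).comp (factorMap n m))
    rw [AlgHom.comp_apply, AlgHom.comp_apply] at this
    rw [this, ← Matrix.det_one (n := Fin t.1.length)]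
    congr 1
    ext1 a b
    have h1 := ht.bounds a.2
    have h2 := ht.bounds b.2
    have hleft : ∀ k : Fin n, ev (if (k : ℕ) < t.1.length ∧ t.1.getD k 0 ≤ t.1.getD a 0 then
        MvPolynomial.X (Sum.inl (⟨t.1.getD a 0 - 1, by omega⟩, k)) else 0) =
        if (k : ℕ) = a then 1 else 0 := fun k => by
      by_cases hk : (k : ℕ) = a
      · rw [if_pos hk, if_pos ⟨hk.trans_lt a.2, by rw [hk]⟩, MvPolynomial.aeval_X, Sum.elim_inl,
          if_pos ⟨hk.trans_lt a.2, by simp only [hk]; omega⟩]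
      · rw [if_neg hk]
        split_ifs with hc
        · rw [MvPolynomial.aeval_X, Sum.elim_inl, if_neg]
          rintro ⟨hk1, hk2⟩
          simp only [Nat.sub_add_cancel h1.1] at hk2
          exact hk (hI.getD_inj hk1 a.2 hk2)
        · exact map_zero _
    have hright : ∀ k : Fin n, ev (if (k : ℕ) < t.1.length ∧ t.2.getD k 0 ≤ t.2.getD b 0 then
        MvPolynomial.X (Sum.inr (k, ⟨t.2.getD b 0 - 1, by omega⟩)) else 0) =
        if (k : ℕ) = b then 1 else 0 := fun k => by
      by_cases hk : (k : ℕ) = b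
      · rw [if_pos hk, if_pos ⟨hk.trans_lt b.2, by rw [hk]⟩, MvPolynomial.aeval_X, Sum.elim_inr,
          if_pos ⟨hk.trans_lt b.2, by simp only [hk]; omega⟩]
      · rw [if_neg hk]
        split_ifs with hc
        · rw [MvPolynomial.aeval_X, Sum.elim_inr, if_neg]
          rintro ⟨hk1, hk2⟩
          simp only [Nat.sub_add_cancel h2.2.2.1] at hk2
          exact hk (hJ.getD_inj (hl ▸ hk1) (hl ▸ b.2) hk2)
        · exact map_zero _
    simp only [Matrix.of_apply, AlgHom.comp_apply, factorMap, MvPolynomial.aeval_X, map_sum,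
      map_mul, restrictTo, Sum.elim_inl, Sum.elim_inr, Nat.sub_add_cancel h1.1,
      Nat.sub_add_cancel h2.2.2.1, hleft, hright]
    rw [Finset.sum_eq_single (⟨a, a.2.trans_le ht.length_le⟩ : Fin n)]
    · simp [Matrix.one_apply, Fin.ext_iff]
    · intro k _ hk
      rw [if_neg fun h => hk (Fin.ext h), zero_mul]
    · simp
  intro h
  rw [h, map_zero] at hev
  exact zero_ne_one hev

theorem tleq_antisymm {n m : ℕ} {s t : List ℕ × List ℕ} (hs : isTab n m s.1 s.2)
    (ht : isTab n m t.1 t.2) (hst : tleq s t) (hts : tleq t s) : s = t := by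
  have hl : s.1.length = t.1.length := le_antisymm hts.1 hst.1
  refine Prod.ext (List.ext_getElem hl fun r h1 h2 => ?_)
    (List.ext_getElem (by rw [← hs.1, ← ht.1, hl]) fun r h1 h2 => ?_)
  · have := le_antisymm (hst.2 r h2).1 (hts.2 r h1).1
    rwa [List.getD_eq_getElem _ _ h1, List.getD_eq_getElem _ _ h2] at this
  · have := le_antisymm (hst.2 r (ht.1 ▸ h2)).2 (hts.2 r (hs.1 ▸ h1)).2
    rwa [List.getD_eq_getElem _ _ h1, List.getD_eq_getElem _ _ h2] at this

theorem exists_maximal_tleq (H : Finset (List ℕ × List ℕ)) (hH : H.Nonempty) :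
    ∃ t ∈ H, ∀ h ∈ H, tleq t h → tleq h t := by
  let r : H → H → Prop := fun x y => tleq y x ∧ ¬ tleq x y
  have : IsTrans H r := ⟨fun x y z h h' =>
    ⟨tleq_trans h'.1 h.1, fun h'' => h'.2 (tleq_trans h.1 h'')⟩⟩
  have : Std.Irrefl r := ⟨fun x h => h.2 h.1⟩
  have hwf : WellFounded r := Finite.wellFounded_of_trans_of_irrefl r
  obtain ⟨x, hx⟩ := hH
  obtain ⟨t, -, ht⟩ := hwf.has_min Set.univ ⟨⟨x, hx⟩, trivial⟩
  exact ⟨t, t.2, fun h hh hth => by_contra fun hn => ht ⟨h, hh⟩ trivial ⟨hth, hn⟩⟩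

/-- Standard monomials are linearly independent after restriction along any `κ` through which the
restrictions attached to their factors all pass. -/
theorem coeff_eq_zero_of_sum_standard {n m : ℕ} (d : ℕ)
    (κ : FactorRing n m →ₐ[ℂ] FactorRing n m) (s : Finset (List (List ℕ × List ℕ)))
    (c : List (List ℕ × List ℕ) → ℂ) (htab : ∀ L ∈ s, ∀ t ∈ L, isTab n m t.1 t.2)
    (hstd : ∀ L ∈ s, L.Pairwise tleq) (hlen : ∀ L ∈ s, L.length ≤ d)
    (hκ : ∀ L ∈ s, ∀ t ∈ L, (restrictTo n m t).comp κ = restrictTo n m t)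
    (hκ₀ : (restrictTo n m ([], [])).comp κ = restrictTo n m ([], []))
    (hsum : ∑ L ∈ s, c L • κ (factorMap n m (L.map fun t => dmin n m t.1 t.2).prod) = 0) :
    ∀ L ∈ s, c L = 0 := by
  induction d generalizing κ s c with
  | zero =>
    intro L hL
    have hnil : ∀ L ∈ s, L = [] := fun L hL =>
      List.length_eq_zero_iff.1 (Nat.le_zero.1 (hlen L hL))
    rw [Finset.sum_eq_single_of_mem L hL fun L' hL' hne =>
      absurd ((hnil L' hL').trans (hnil L hL).symm) hne, hnil L hL] at hsum
    rw [hnil L hL]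
    simpa using hsum
  | succ d ih =>
    have hnil : [] ∈ s → c [] = 0 := fun h => by
      have h1 := congrArg (restrictTo n m ([], [])) hsum
      simp only [map_sum, map_smul, map_zero, ← AlgHom.comp_apply _ κ, hκ₀] at h1
      rw [Finset.sum_eq_single_of_mem [] h] at h1
      · simpa using h1
      · intro L hL hne
        obtain ⟨t, T, rfl⟩ := List.exists_cons_of_ne_nil hne
        have ht := htab _ hL t List.mem_cons_self
        rw [List.map_cons, List.prod_cons, map_mul, map_mul,
          restrictTo_factorMap_dmin_eq_zero ht rfl (by simp) (by simp), zero_mul, smul_zero]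
        intro hle
        exact ht.2.1 (List.length_eq_zero_iff.1 (Nat.le_zero.1 hle.1))
    by_contra! hne
    obtain ⟨L₀, hL₀, hc₀⟩ := hne
    let H : Finset (List ℕ × List ℕ) := (s.filter fun L => L ≠ [] ∧ c L ≠ 0).image
      fun L => L.headD ([], [])
    have hmemH : ∀ t, t ∈ H ↔ ∃ T, t :: T ∈ s ∧ c (t :: T) ≠ 0 := fun t => by
      simp only [H, Finset.mem_image, Finset.mem_filter]
      constructor
      · rintro ⟨L, ⟨hL, hne, hc⟩, rfl⟩
        obtain ⟨t, T, rfl⟩ := List.exists_cons_of_ne_nil hne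
        exact ⟨T, hL, hc⟩
      · rintro ⟨T, hT, hc⟩
        exact ⟨t :: T, ⟨hT, by simp, hc⟩, rfl⟩
    have hH : H.Nonempty := by
      rcases L₀ with _ | ⟨t, T⟩
      · exact absurd (hnil hL₀) hc₀
      · exact ⟨t, (hmemH t).2 ⟨T, hL₀, hc₀⟩⟩
    obtain ⟨t, htH, hmax⟩ := exists_maximal_tleq H hH
    obtain ⟨T₀, hT₀, hcT₀⟩ := (hmemH t).1 htH
    have ht := htab _ hT₀ t List.mem_cons_self
    have hinj : Function.Injective (List.cons t) := List.cons_injective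
    refine hcT₀ (ih (restrictTo n m t) (s.preimage (List.cons t) hinj.injOn)
      (fun T => c (t :: T)) ?_ ?_ ?_ ?_ ?_ ?_ T₀ (Finset.mem_preimage.2 hT₀))
    · intro T hT u hu
      exact htab _ (Finset.mem_preimage.1 hT) u (List.mem_cons_of_mem _ hu)
    · intro T hT
      exact (List.pairwise_cons.1 (hstd _ (Finset.mem_preimage.1 hT))).2
    · intro T hT
      exact Nat.succ_le_succ_iff.1 (hlen _ (Finset.mem_preimage.1 hT))
    · intro T hT u hu
      exact restrictTo_comp ((List.pairwise_cons.1 (hstd _ (Finset.mem_preimage.1 hT))).1 u hu)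
    · exact restrictTo_comp ⟨Nat.zero_le _, fun r hr => absurd hr (Nat.not_lt_zero r)⟩
    · refine (mul_eq_zero.1 ?_).resolve_left (restrictTo_factorMap_dmin_ne_zero ht)
      have h1 := congrArg (restrictTo n m t) hsum
      simp only [map_sum, map_smul, map_zero, ← AlgHom.comp_apply _ κ,
        hκ _ hT₀ t List.mem_cons_self] at h1
      rw [← h1, Finset.mul_sum]
      refine Finset.sum_of_injOn (List.cons t) hinj.injOn
        (fun T hT => Finset.mem_preimage.1 hT) ?_ ?_
      · intro L hL hLt
        rcases L with _ | ⟨u, T⟩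
        · rw [hnil hL, zero_smul]
        by_cases hc : c (u :: T) = 0
        · rw [hc, zero_smul]
        have hu := htab _ hL u List.mem_cons_self
        rw [List.map_cons, List.prod_cons, map_mul, map_mul,
          restrictTo_factorMap_dmin_eq_zero hu ht.1 ht.2.2.1 ht.2.2.2.1, zero_mul, smul_zero]
        intro htu
        obtain rfl := tleq_antisymm ht hu htu (hmax u ((hmemH u).2 ⟨T, hL, hc⟩) htu)
        exact hLt ⟨T, Finset.mem_preimage.2 hL, rfl⟩
      · intro T _
        rw [List.map_cons, List.prod_cons, map_mul, map_mul, mul_smul_comm]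

theorem linearIndependent_standard (n m : ℕ) :
    LinearIndependent ℂ (fun L : {L : List (List ℕ × List ℕ) //
        (∀ t ∈ L, isTab n m t.1 t.2) ∧ L.IsChain tleq} =>
      ((L : List (List ℕ × List ℕ)).map fun t => dmin n m t.1 t.2).prod) := by
  classical
  rw [linearIndependent_iff']
  intro s g hg L hL
  let c : List (List ℕ × List ℕ) → ℂ := fun L =>
    if h : (∀ t ∈ L, isTab n m t.1 t.2) ∧ L.IsChain tleq then g ⟨L, h⟩ else 0
  have hc : ∀ L : {L : List (List ℕ × List ℕ) //
      (∀ t ∈ L, isTab n m t.1 t.2) ∧ L.IsChain tleq}, c L = g L := fun L => dif_pos L.2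
  rw [← hc L]
  refine coeff_eq_zero_of_sum_standard (n := n) (m := m)
    ((s.map (Function.Embedding.subtype _)).sup List.length)
    (AlgHom.id ℂ (FactorRing n m)) (s.map (Function.Embedding.subtype _)) c ?_ ?_
    (fun L hL => Finset.le_sup (f := List.length) hL) (fun _ _ _ _ => AlgHom.comp_id _)
    (AlgHom.comp_id _) ?_ L (Finset.mem_map_of_mem _ hL)
  · intro L hL
    obtain ⟨L, -, rfl⟩ := Finset.mem_map.1 hL
    exact L.2.1
  · intro L hL
    obtain ⟨L, -, rfl⟩ := Finset.mem_map.1 hL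
    exact List.isChain_iff_pairwise.1 L.2.2
  · have := congrArg (factorMap n m) hg
    rw [map_zero, map_sum] at this
    rw [Finset.sum_map, ← this]
    refine Finset.sum_congr rfl fun L _ => ?_
    rw [map_smul, ← hc L]
    rfl

end Independence

/-- Corollary `GLSMT`. The standard monomials `Δ(t)`, for `t` ranging over
all standard tableaux (multichains in `D(n,m)`, including the empty one), form a ℂ-basis of
`ℂ[M_{n,m}]`: they are linearly independent and span. -/
theorem standard_monomials_basis (n m : ℕ) (hn : 0 < n) (hm : 0 < m) :
    LinearIndependent ℂ
      (fun L : {L : List (List ℕ × List ℕ) //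
          (∀ t ∈ L, isTab n m t.1 t.2) ∧ L.Chain' tleq} =>
        ((L : List (List ℕ × List ℕ)).map fun t => dmin n m t.1 t.2).prod) ∧
    Submodule.span ℂ {f : MvPolynomial (Fin n × Fin m) ℂ |
      ∃ L : List (List ℕ × List ℕ), (∀ t ∈ L, isTab n m t.1 t.2) ∧ L.Chain' tleq ∧
        f = (L.map fun t => dmin n m t.1 t.2).prod} = ⊤ :=
  ⟨linearIndependent_standard n m, span_standard_eq_top n m⟩

end
end

section
/- The restriction map p ↦ p|_{Γ_{n,m}} descends to a well-defined isomorphism of additive monoids from the quotient monoid P_{n,m} = P(n,m)/⟨p_{1̂}⟩ onto the additive monoid of all order-preserving maps Γ_{n,m} → ℤ_{≥0}; in particular every element of P_{n,m} is uniquely represented by an order-preserving map from Γ_{n,m} to the nonnegative integers. -/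
noncomputable section

/-- `inGT m (i,j)` : `z_j^{(i)}` is a point of the Gelfand–Tsetlin poset Γ_m. -/
def inGT (m : ℕ) (z : ℕ × ℕ) : Prop := 1 ≤ z.2 ∧ z.2 ≤ z.1 ∧ z.1 ≤ m

/-- The Gelfand–Tsetlin order: `gtLE (a,b) (i,j)` means `z_b^{(a)} ≤ z_j^{(i)}` in the partial
order generated by `z_j^{(i+1)} ≥ z_j^{(i)} ≥ z_{j+1}^{(i+1)}`. -/
def gtLE (z w : ℕ × ℕ) : Prop := w.2 ≤ z.2 ∧ z.1 + w.2 ≤ w.1 + z.2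

/-- A GT pattern of `GL_m` : an order preserving map Γ_m → ℤ_{≥0}
(extended by 0 off the poset). -/
def IsGTPattern (m : ℕ) (p : ℕ × ℕ → ℕ) : Prop :=
  (∀ z, ¬ inGT m z → p z = 0) ∧
    ∀ z w, inGT m z → inGT m w → gtLE z w → p z ≤ p w

/-- `pCol m J` is the GT pattern of `GL_m` corresponding (via the bijection of
[pattern2tableau]) to the single-column semistandard tableau with entries `J`. -/
def pCol (m : ℕ) (J : List ℕ) : ℕ × ℕ → ℕ := fun z =>
  if 1 ≤ z.2 ∧ z.2 ≤ z.1 ∧ z.1 ≤ m ∧ z.2 ≤ J.countP (fun x => decide (x ≤ z.1)) then 1 else 0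

/-- `memPl n M K` : `K` is a strictly increasing sequence of length `n` in `{1,…,M}`,
i.e. an element of `Pl(n,M)`. -/
def memPl (n M : ℕ) (K : List ℕ) : Prop :=
  K.length = n ∧ K.Chain' (· < ·) ∧ ∀ x ∈ K, 1 ≤ x ∧ x ≤ M

/-- The semigroup `𝒫(n,m)` of GT patterns generated by the `p_K`, `K ∈ Pl(n,m+n)`. -/
def Pnm (n m : ℕ) : AddSubmonoid ((ℕ × ℕ) → ℕ) :=
  AddSubmonoid.closure {p | ∃ K : List ℕ, memPl n (m + n) K ∧ p = pCol (m + n) K}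

/-- The poset `Γ_{n,m} = Γ_{m+n}^n \\ {z : z ≥ z_n^{(m+n)}}`. -/
def GammaSet (n m : ℕ) : Set (ℕ × ℕ) :=
  {z | inGT (m + n) z ∧ z.2 ≤ n ∧ ¬ gtLE (m + n, n) z}

/-- The additive monoid of order preserving maps `S → ℤ_{≥0}` (extended by 0 off `S`),
where `S` carries the GT order. -/
def coneMonoid (S : Set (ℕ × ℕ)) : AddSubmonoid ((ℕ × ℕ) → ℕ) where
  carrier := {q | (∀ z ∉ S, q z = 0) ∧ ∀ z w, z ∈ S → w ∈ S → gtLE z w → q z ≤ q w}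
  zero_mem' := ⟨fun _ _ => rfl, fun _ _ _ _ _ => le_refl _⟩
  add_mem' := by
    rintro a b ⟨ha0, ha1⟩ ⟨hb0, hb1⟩
    refine ⟨fun z hz => ?_, fun z w hz hw h => ?_⟩
    · simp [Pi.add_apply, ha0 z hz, hb0 z hz]
    · exact add_le_add (ha1 z w hz hw h) (hb1 z w hz hw h)

def topL (n m : ℕ) : List ℕ := (List.range n).map fun r => m + r + 1

theorem mem_gammaSet_iff {n m i j : ℕ} :
    (i, j) ∈ GammaSet n m ↔ 1 ≤ j ∧ j ≤ i ∧ j ≤ n ∧ i < m + j := by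
  simp only [GammaSet, inGT, gtLE, Set.mem_ofPred_eq]
  omega

/-- A strictly increasing sequence in `{1,…,M}` extends to a strictly increasing function. -/
theorem memPl.exists_strictMono {n M : ℕ} {K : List ℕ} (hK : memPl n M K) :
    ∃ k : ℕ → ℕ, StrictMono k ∧ 1 ≤ k 0 ∧ (∀ j < n, k j ≤ M) ∧ K = (List.range n).map k := by
  obtain ⟨rfl, hc, hM⟩ := hK
  have hsorted : K.Pairwise (· < ·) := List.isChain_iff_pairwise.mp hc
  have hlt : ∀ j (h : j < K.length), K.getD j (M + j + 1) = K[j] := fun j h => by simp [h]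
  have hge : ∀ j, K.length ≤ j → K.getD j (M + j + 1) = M + j + 1 := fun j h => by simp [h]
  refine ⟨fun j => K.getD j (M + j + 1), strictMono_nat_of_lt_succ fun j => ?_, ?_, ?_, ?_⟩
  · by_cases h : j + 1 < K.length
    · rw [hlt j (by omega), hlt _ h]
      exact List.pairwise_iff_getElem.mp hsorted _ _ _ _ (Nat.lt_succ_self j)
    · rw [hge (j + 1) (by omega)]
      by_cases h' : j < K.length
      · rw [hlt j h']
        have := (hM _ (List.getElem_mem h')).2
        omega
      · rw [hge j (by omega)]
        omega
  · dsimp only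
    by_cases h : 0 < K.length
    · rw [hlt 0 h]
      exact (hM _ (List.getElem_mem h)).1
    · rw [hge 0 (by omega)]
      omega
  · intro j h
    dsimp only
    rw [hlt j h]
    exact (hM _ (List.getElem_mem h)).2
  · refine List.ext_getElem (by simp) fun j h _ => ?_
    simp [h]

theorem memPl_map_range {n M : ℕ} {k : ℕ → ℕ} (hk : StrictMono k) (h0 : 1 ≤ k 0)
    (hM : ∀ j < n, k j ≤ M) : memPl n M ((List.range n).map k) := by
  refine ⟨by simp, List.isChain_iff_pairwise.mpr ?_, ?_⟩
  · exact List.pairwise_map.mpr (List.pairwise_lt_range.imp fun h => hk h)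
  · intro x hx
    obtain ⟨j, hj, rfl⟩ := List.mem_map.mp hx
    exact ⟨h0.trans (hk.monotone (Nat.zero_le j)), hM j (List.mem_range.mp hj)⟩

theorem lt_countP_map_range_iff {k : ℕ → ℕ} (hk : StrictMono k) (n i j : ℕ) :
    j < ((List.range n).map k).countP (fun x => decide (x ≤ i)) ↔ j < n ∧ k j ≤ i := by
  induction n generalizing j with
  | zero => simp
  | succ n ih =>
    have hle : ((List.range n).map k).countP (fun x => decide (x ≤ i)) ≤ n := by
      simpa using List.countP_le_length (p := fun x => decide (x ≤ i)) (l := (List.range n).map k)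
    rw [List.range_succ, List.map_append, List.countP_append]
    by_cases hn : k n ≤ i
    · have hall : ∀ l ≤ n, k l ≤ i := fun l hl => (hk.monotone hl).trans hn
      have hge : n ≤ ((List.range n).map k).countP (fun x => decide (x ≤ i)) := by
        by_contra! hlt
        exact absurd ((ih _).mpr ⟨hlt, hall _ hle⟩) (lt_irrefl _)
      simp only [List.map_cons, List.map_nil, List.countP_singleton, hn, decide_true, if_true]
      exact ⟨fun h => ⟨by omega, hall j (by omega)⟩, fun h => by omega⟩
    · simp only [List.map_cons, List.map_nil, List.countP_singleton, hn, decide_false,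
        Bool.false_eq_true, if_false, add_zero, ih]
      refine ⟨fun h => ⟨by omega, h.2⟩, fun h => ⟨?_, h.2⟩⟩
      have : j ≠ n := by
        rintro rfl
        exact hn h.2
      omega

theorem StrictMono.succ_le_of_one_le {k : ℕ → ℕ} (hk : StrictMono k) (h0 : 1 ≤ k 0) (j : ℕ) :
    j + 1 ≤ k j := by
  have := hk.add_le_nat j 0
  simp only [Nat.add_zero] at this
  omega

theorem pCol_map_range {k : ℕ → ℕ} (hk : StrictMono k) (h0 : 1 ≤ k 0) (n M i j : ℕ) :
    pCol M ((List.range n).map k) (i, j + 1) = if i ≤ M ∧ j < n ∧ k j ≤ i then 1 else 0 := by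
  have hj := hk.succ_le_of_one_le h0 j
  have hcount := lt_countP_map_range_iff hk n i j
  unfold pCol
  refine if_congr ?_ rfl rfl
  simp only [Nat.succ_le_iff, hcount]
  omega

theorem pCol_eq_zero_of_not_inGT {M : ℕ} (K : List ℕ) {z : ℕ × ℕ} (hz : ¬ inGT M z) :
    pCol M K z = 0 :=
  if_neg fun h => hz ⟨h.1, h.2.1, h.2.2.1⟩

theorem strictMono_add_add_one (m : ℕ) : StrictMono fun r : ℕ => m + r + 1 :=
  fun a b h => by dsimp only; omega

theorem pCol_topL_of_mem {n m : ℕ} {z : ℕ × ℕ} (hz : z ∈ GammaSet n m) :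
    pCol (m + n) (topL n m) z = 0 := by
  obtain ⟨i, j⟩ := z
  rw [mem_gammaSet_iff] at hz
  obtain ⟨j, rfl⟩ := Nat.exists_eq_add_of_le' hz.1
  rw [topL, pCol_map_range (strictMono_add_add_one m) (by omega), if_neg]
  omega

/-- Outside `Γ_{n,m}`, every `p_K` agrees with `p_1̂`. -/
theorem pCol_eq_topL_of_notMem {n m : ℕ} {K : List ℕ} (hK : memPl n (m + n) K) {z : ℕ × ℕ}
    (hz : z ∉ GammaSet n m) : pCol (m + n) K z = pCol (m + n) (topL n m) z := by
  obtain ⟨k, hk, h0, hM, rfl⟩ := hK.exists_strictMono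
  by_cases hGT : inGT (m + n) z
  · obtain ⟨i, j⟩ := z
    rw [mem_gammaSet_iff] at hz
    obtain ⟨h1, h2, h3⟩ := hGT
    dsimp only at h1 h2 h3
    obtain ⟨j, rfl⟩ := Nat.exists_eq_add_of_le' h1
    rw [topL, pCol_map_range hk h0, pCol_map_range (strictMono_add_add_one m) (by omega)]
    refine if_congr (and_congr_right fun _ => and_congr_right fun hj => ?_) rfl rfl
    have hlast := hM (n - 1) (by omega)
    have hshift := hk.add_le_nat (n - 1 - j) j
    rw [show n - 1 - j + j = n - 1 by omega] at hshift
    omega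
  · rw [pCol_eq_zero_of_not_inGT _ hGT, pCol_eq_zero_of_not_inGT _ hGT]

theorem pCol_mono {n M : ℕ} {K : List ℕ} (hK : memPl n M K) {z w : ℕ × ℕ}
    (hz : inGT M z) (hw : inGT M w) (h : gtLE z w) : pCol M K z ≤ pCol M K w := by
  obtain ⟨k, hk, h0, -, rfl⟩ := hK.exists_strictMono
  obtain ⟨i, j⟩ := z
  obtain ⟨i', j'⟩ := w
  simp only [inGT, gtLE] at hz hw h
  obtain ⟨j, rfl⟩ := Nat.exists_eq_add_of_le' hz.1
  obtain ⟨j', rfl⟩ := Nat.exists_eq_add_of_le' hw.1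
  rw [pCol_map_range hk h0, pCol_map_range hk h0]
  by_cases hzk : i ≤ M ∧ j < n ∧ k j ≤ i
  · have hshift := hk.add_le_nat (j - j') j'
    rw [show j - j' + j' = j by omega] at hshift
    rw [if_pos (by omega : i' ≤ M ∧ j' < n ∧ k j' ≤ i')]
    split <;> simp
  · simp [hzk]

theorem indicator_mem_coneMonoid {n m : ℕ} {p : ℕ × ℕ → ℕ} (hp : p ∈ Pnm n m) :
    (GammaSet n m).indicator p ∈ coneMonoid (GammaSet n m) := by
  induction hp using AddSubmonoid.closure_induction with
  | mem p hp =>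
    obtain ⟨K, hK, rfl⟩ := hp
    refine ⟨fun z hz => Set.indicator_of_notMem hz _, fun z w hz hw h => ?_⟩
    rw [Set.indicator_of_mem hz, Set.indicator_of_mem hw]
    exact pCol_mono hK hz.1 hw.1 h
  | zero =>
    rw [Set.indicator_zero']
    exact zero_mem _
  | add p p' _ _ hp hp' =>
    rw [Set.indicator_add']
    exact add_mem hp hp'

/-- Outside `Γ_{n,m}`, every element of `𝒫(n,m)` is a multiple of `p_1̂`. -/
theorem exists_eq_smul_topL {n m : ℕ} {p : ℕ × ℕ → ℕ} (hp : p ∈ Pnm n m) :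
    ∃ c : ℕ, ∀ z ∉ GammaSet n m, p z = c * pCol (m + n) (topL n m) z := by
  induction hp using AddSubmonoid.closure_induction with
  | mem p hp =>
    obtain ⟨K, hK, rfl⟩ := hp
    exact ⟨1, fun z hz => by rw [one_mul, pCol_eq_topL_of_notMem hK hz]⟩
  | zero => exact ⟨0, fun z _ => by simp⟩
  | add p p' _ _ hp hp' =>
    obtain ⟨c, hc⟩ := hp
    obtain ⟨c', hc'⟩ := hp'
    exact ⟨c + c', fun z hz => by rw [Pi.add_apply, hc z hz, hc' z hz, add_mul]⟩

theorem indicator_eq_iff_exists_add_smul_topL {n m : ℕ} {p p' : ℕ × ℕ → ℕ} (hp : p ∈ Pnm n m)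
    (hp' : p' ∈ Pnm n m) :
    (GammaSet n m).indicator p = (GammaSet n m).indicator p' ↔
      ∃ a a' : ℕ, p + a • pCol (m + n) (topL n m) = p' + a' • pCol (m + n) (topL n m) := by
  constructor
  · intro h
    obtain ⟨c, hc⟩ := exists_eq_smul_topL hp
    obtain ⟨c', hc'⟩ := exists_eq_smul_topL hp'
    refine ⟨c', c, funext fun z => ?_⟩
    simp only [Pi.add_apply, Pi.smul_apply, smul_eq_mul]
    by_cases hz : z ∈ GammaSet n m
    · have hpz := congrFun h z
      rw [Set.indicator_of_mem hz, Set.indicator_of_mem hz] at hpz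
      rw [pCol_topL_of_mem hz, hpz, mul_zero, mul_zero]
    · rw [hc z hz, hc' z hz, add_comm]
  · rintro ⟨a, a', h⟩
    refine Set.indicator_congr fun z hz => ?_
    have hpz := congrFun h z
    simpa [pCol_topL_of_mem hz] using hpz

/-- The superlevel sets of an order-preserving map on `Γ_{n,m}` are cut out by the `p_K`. -/
theorem exists_pCol_eq_superlevel {n m : ℕ} {q : ℕ × ℕ → ℕ}
    (hq : q ∈ coneMonoid (GammaSet n m)) (t : ℕ) :
    ∃ K, memPl n (m + n) K ∧
      ∀ z ∈ GammaSet n m, pCol (m + n) K z = if t < q z then 1 else 0 := by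
  obtain ⟨hq0, hqmono⟩ := hq
  have hex : ∀ j, ∃ i, j + 1 ≤ i ∧ (i < m + j + 1 → t < q (i, j + 1)) :=
    fun j => ⟨m + j + 1, by omega, fun h => absurd h (lt_irrefl _)⟩
  classical
  let k : ℕ → ℕ := fun j => Nat.find (hex j)
  have hspec : ∀ j, j + 1 ≤ k j ∧ (k j < m + j + 1 → t < q (k j, j + 1)) :=
    fun j => Nat.find_spec (hex j)
  have hmin : ∀ j i, j + 1 ≤ i → (i < m + j + 1 → t < q (i, j + 1)) → k j ≤ i :=
    fun j i h h' => Nat.find_min' (hex j) ⟨h, h'⟩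
  have hk : StrictMono k := by
    refine strictMono_nat_of_lt_succ fun j => ?_
    obtain ⟨h1, h2⟩ := hspec (j + 1)
    have hle : k j ≤ k (j + 1) - 1 := by
      refine hmin j _ (by omega) fun h => ?_
      have hlt := h2 (by omega)
      have hmem : (k (j + 1), j + 1 + 1) ∈ GammaSet n m := by
        by_contra hmem
        rw [hq0 _ hmem] at hlt
        exact Nat.not_lt_zero _ hlt
      have hmem' := mem_gammaSet_iff.mp hmem
      exact hlt.trans_le (hqmono _ _ hmem (mem_gammaSet_iff.mpr (by omega))
        ⟨by dsimp only; omega, by dsimp only; omega⟩)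
    omega
  have hM : ∀ j < n, k j ≤ m + n := fun j hj =>
    (hmin j (m + j + 1) (by omega) fun h => absurd h (lt_irrefl _)).trans (by omega)
  refine ⟨_, memPl_map_range hk (hspec 0).1 hM, ?_⟩
  rintro ⟨i, j⟩ hz
  have hz' := mem_gammaSet_iff.mp hz
  obtain ⟨j, rfl⟩ := Nat.exists_eq_add_of_le' hz'.1
  rw [pCol_map_range hk (hspec 0).1]
  refine if_congr ⟨fun ⟨_, _, h⟩ => ?_, fun h => ?_⟩ rfl rfl
  · obtain ⟨h1, h2⟩ := hspec j
    exact (h2 (by omega)).trans_le (hqmono _ _ (mem_gammaSet_iff.mpr (by omega)) hz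
      ⟨le_rfl, by dsimp only; omega⟩)
  · exact ⟨by omega, by omega, hmin j i hz'.2.1 fun _ => h⟩

theorem exists_indicator_eq {n m : ℕ} {q : ℕ × ℕ → ℕ} (hq : q ∈ coneMonoid (GammaSet n m)) :
    ∃ p ∈ Pnm n m, (GammaSet n m).indicator p = q := by
  choose K hK hKq using exists_pCol_eq_superlevel hq
  refine ⟨∑ t ∈ Finset.range (q (m, 1)), pCol (m + n) (K t),
    sum_mem fun t _ => AddSubmonoid.subset_closure ⟨K t, hK t, rfl⟩, funext fun z => ?_⟩
  by_cases hz : z ∈ GammaSet n m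
  · have hle : q z ≤ q (m, 1) := by
      obtain ⟨i, j⟩ := z
      have hz' := mem_gammaSet_iff.mp hz
      exact hq.2 _ _ hz (mem_gammaSet_iff.mpr (by omega))
        ⟨by dsimp only; omega, by dsimp only; omega⟩
    have hfilter : (Finset.range (q (m, 1))).filter (· < q z) = Finset.range (q z) := by
      ext t
      simp only [Finset.mem_filter, Finset.mem_range]
      omega
    rw [Set.indicator_of_mem hz, Finset.sum_apply, Finset.sum_congr rfl fun t _ => hKq t z hz,
      ← Finset.card_filter, hfilter, Finset.card_range]
  · rw [Set.indicator_of_notMem hz, hq.1 z hz]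

/-- Restriction to `Γ_{n,m}` descends to a well-defined isomorphism of
additive monoids from `𝒫_{n,m} = 𝒫(n,m)/⟨p_1̂⟩` onto the monoid of order preserving maps
`Γ_{n,m} → ℤ_{≥0}` : restriction maps `𝒫(n,m)` into the target monoid, two elements have
the same restriction iff they agree modulo multiples of `p_1̂`, restriction is onto the
target monoid, and it is additive. -/
theorem quotient_pattern_monoid_isom (n m : ℕ) (hn : 0 < n) (hm : 0 < m) :
    (∀ p ∈ Pnm n m, (GammaSet n m).indicator p ∈ coneMonoid (GammaSet n m)) ∧
    (∀ p ∈ Pnm n m, ∀ p' ∈ Pnm n m,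
      ((GammaSet n m).indicator p = (GammaSet n m).indicator p' ↔
        ∃ a a' : ℕ, p + a • pCol (m + n) (topL n m) = p' + a' • pCol (m + n) (topL n m))) ∧
    (∀ q ∈ coneMonoid (GammaSet n m), ∃ p ∈ Pnm n m, (GammaSet n m).indicator p = q) ∧
    (∀ p p' : (ℕ × ℕ) → ℕ,
      (GammaSet n m).indicator (p + p') =
        (GammaSet n m).indicator p + (GammaSet n m).indicator p') := by
  exact ⟨fun _ => indicator_mem_coneMonoid,
    fun _ hp _ hp' => indicator_eq_iff_exists_add_smul_topL hp hp',
    fun _ => exists_indicator_eq, Set.indicator_add' _⟩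

end
end

section
/- Let A, B ∈ D(n,m) and let δ_A δ_B = Σ_r c_r δ_{X_r} δ_{Y_r} be the standard expression of δ_A δ_B in ℂ[M_{n,m}] (a ℂ-linear combination of standard monomials, with δ_{Y_r} possibly equal to 1). Then wt(A) + wt(B) ≥ wt(X_r) + wt(Y_r) for every r appearing with nonzero coefficient, and equality holds only for (X_r, Y_r) = (A∧B, A∨B). -/
noncomputable section

/-- The map ξ : `ξ([I:J]) = [j₁,…,jₕ, m+u₁,…,m+u_{n−h}]` where
`{n+1−u₁,…,n+1−u_{n−h}}` is the complement of `I` in `{1,…,n}`. -/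
def xi (n m : ℕ) (I J : List ℕ) : List ℕ :=
  J ++ ((((List.range n).map (· + 1)).filter fun c => decide (c ∉ I)).reverse.map
      fun c => m + (n + 1 - c))

def xiInvI (n m : ℕ) (K : List ℕ) : List ℕ :=
  ((List.range n).map (· + 1)).filter fun i => decide (m + (n + 1 - i) ∉ K)

def xiInvJ (m : ℕ) (K : List ℕ) : List ℕ := K.filter fun x => decide (x ≤ m)

/-- The meet `A ∧ B` in the distributive lattice `D(n,m)`, computed by transporting the
entrywise minimum through the order isomorphism ξ. -/
def tabMeet (n m : ℕ) (A B : List ℕ × List ℕ) : List ℕ × List ℕ :=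
  (xiInvI n m (List.zipWith min (xi n m A.1 A.2) (xi n m B.1 B.2)),
    xiInvJ m (List.zipWith min (xi n m A.1 A.2) (xi n m B.1 B.2)))

/-- The join `A ∨ B` in the distributive lattice `D(n,m)`. -/
def tabJoin (n m : ℕ) (A B : List ℕ × List ℕ) : List ℕ × List ℕ :=
  (xiInvI n m (List.zipWith max (xi n m A.1 A.2) (xi n m B.1 B.2)),
    xiInvJ m (List.zipWith max (xi n m A.1 A.2) (xi n m B.1 B.2)))

/-- Weight of a length-`n` column list `K = [q₁,…,qₙ]` : `∑ (m+r−q_r)·N^{n−r}`. -/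
def wtL (n m N : ℕ) (K : List ℕ) : ℕ :=
  ∑ r ∈ Finset.range n, (m + (r + 1) - K.getD r 0) * N ^ (n - 1 - r)

/-- Weight of a one-line tableau `[I:J]`, via ξ. -/
def wtTab (n m N : ℕ) (t : List ℕ × List ℕ) : ℕ := wtL n m N (xi n m t.1 t.2)

/-- The complement of `I` in `{1, …, n}`, in increasing order. -/
def rowCompl (n : ℕ) (I : List ℕ) : List ℕ :=
  ((List.range n).map (· + 1)).filter fun c => decide (c ∉ I)

lemma xi_eq (n m : ℕ) (I J : List ℕ) :
    xi n m I J = J ++ (rowCompl n I).reverse.map fun c => m + (n + 1 - c) := rfl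

lemma pairwise_lt_range_succ (n : ℕ) : ((List.range n).map (· + 1)).Pairwise (· < ·) := by
  rw [List.pairwise_map]
  exact List.pairwise_lt_range.imp (by intros; omega)

lemma mem_range_succ {n c : ℕ} : c ∈ (List.range n).map (· + 1) ↔ 1 ≤ c ∧ c ≤ n := by
  simp only [List.mem_map, List.mem_range]
  exact ⟨by rintro ⟨a, h, rfl⟩; omega, fun h => ⟨c - 1, by omega, by omega⟩⟩

lemma mem_rowCompl {n c : ℕ} {I : List ℕ} : c ∈ rowCompl n I ↔ (1 ≤ c ∧ c ≤ n) ∧ c ∉ I := by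
  rw [rowCompl, List.mem_filter, mem_range_succ, decide_eq_true_iff]

lemma pairwise_lt_rowCompl (n : ℕ) (I : List ℕ) : (rowCompl n I).Pairwise (· < ·) :=
  (pairwise_lt_range_succ n).filter _

lemma nodup_of_pairwise_lt {l : List ℕ} (h : l.Pairwise (· < ·)) : l.Nodup :=
  h.imp fun h => h.ne

lemma getD_lt_iff_lt_countP {l : List ℕ} (h : l.Pairwise (· < ·)) (c : ℕ) {k : ℕ}
    (hk : k < l.length) : l.getD k 0 < c ↔ k < l.countP (decide <| · < c) := by
  induction l generalizing k with
  | nil => simp at hk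
  | cons a l ih =>
    rw [List.pairwise_cons] at h
    by_cases hac : a < c
    · rw [List.countP_cons_of_pos (by simpa using hac)]
      cases k with
      | zero => simpa using hac
      | succ k =>
        simp only [List.length_cons, Nat.add_lt_add_iff_right] at hk
        simpa using ih h.2 hk
    · have h0 : (a :: l).countP (decide <| · < c) = 0 := by
        rw [List.countP_eq_zero]
        intro x hx
        rcases List.mem_cons.1 hx with rfl | hx
        · simpa using hac
        · have := h.1 x hx
          simp only [decide_eq_true_eq]; omega
      rw [h0]
      have : a ≤ (a :: l).getD k 0 := by
        cases k with
        | zero => simp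
        | succ k =>
          simp only [List.length_cons, Nat.add_lt_add_iff_right] at hk
          simp only [List.getD_cons_succ, List.getD_eq_getElem _ _ hk]
          exact (h.1 _ (List.getElem_mem hk)).le
      omega

namespace isTab

variable {n m : ℕ} {I J : List ℕ}

lemma pairwise_left (h : isTab n m I J) : I.Pairwise (· < ·) :=
  List.isChain_iff_pairwise.1 h.2.2.1

lemma pairwise_right (h : isTab n m I J) : J.Pairwise (· < ·) :=
  List.isChain_iff_pairwise.1 h.2.2.2.1

lemma perm_append_rowCompl (h : isTab n m I J) :
    (I ++ rowCompl n I).Perm ((List.range n).map (· + 1)) := by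
  rw [List.perm_ext_iff_of_nodup _ (nodup_of_pairwise_lt (pairwise_lt_range_succ n))]
  · intro c
    rw [List.mem_append, mem_rowCompl, mem_range_succ]
    have := h.2.2.2.2.1 c
    tauto
  · refine List.Nodup.append (nodup_of_pairwise_lt h.pairwise_left)
      (nodup_of_pairwise_lt (pairwise_lt_rowCompl n I)) fun c hc hc' => (mem_rowCompl.1 hc').2 hc

lemma length_add_length_rowCompl (h : isTab n m I J) :
    I.length + (rowCompl n I).length = n := by
  simpa using h.perm_append_rowCompl.length_eq

lemma length_xi (h : isTab n m I J) : (xi n m I J).length = n := by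
  have := h.length_add_length_rowCompl
  have := h.1
  simp [xi_eq]
  omega

lemma xi_getD_of_lt (h : isTab n m I J) {r : ℕ} (hr : r < I.length) :
    (xi n m I J).getD r 0 = J.getD r 0 := by
  rw [xi_eq, List.getD_append _ _ _ _ (h.1 ▸ hr)]

lemma xi_getD_of_le (h : isTab n m I J) {r : ℕ} (hr : I.length ≤ r) (hrn : r < n) :
    (xi n m I J).getD r 0 = m + (n + 1 - (rowCompl n I).getD (n - 1 - r) 0) := by
  have h1 := h.length_add_length_rowCompl
  have h2 := h.1
  rw [xi_eq, List.getD_append_right _ _ _ _ (h2 ▸ hr), List.getD_eq_getElem _ _ (by simp; omega),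
    List.getElem_map, List.getElem_reverse, List.getD_eq_getElem _ _ (by omega)]
  have hidx : (rowCompl n I).length - 1 - (r - J.length) = n - 1 - r := by omega
  simp only [hidx]

lemma pairwise_xi (h : isTab n m I J) : (xi n m I J).Pairwise (· < ·) := by
  rw [xi_eq, List.pairwise_append]
  refine ⟨h.pairwise_right, ?_, ?_⟩
  · rw [List.pairwise_map, List.pairwise_reverse]
    refine (pairwise_lt_rowCompl n I).imp_of_mem fun ha hb hab => ?_
    have := mem_rowCompl.1 ha
    have := mem_rowCompl.1 hb
    omega
  · intro a ha b hb
    obtain ⟨c, hc, rfl⟩ := List.mem_map.1 hb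
    have := mem_rowCompl.1 (List.mem_reverse.1 hc)
    have := h.2.2.2.2.2 a ha
    omega

lemma xi_getD_lt (h : isTab n m I J) {r s : ℕ} (hrs : r < s) (hs : s < n) :
    (xi n m I J).getD r 0 < (xi n m I J).getD s 0 := by
  have hl := h.length_xi
  rw [List.getD_eq_getElem _ _ (by omega), List.getD_eq_getElem _ _ (by omega)]
  exact List.pairwise_iff_getElem.1 h.pairwise_xi _ _ _ _ hrs

lemma xi_getD_le (h : isTab n m I J) {r : ℕ} (hr : r < n) :
    (xi n m I J).getD r 0 ≤ m + r + 1 := by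
  have key : ∀ k r, r + k + 1 = n → (xi n m I J).getD r 0 ≤ m + r + 1 := by
    intro k
    induction k with
    | zero =>
      intro r hr
      have hl := h.length_xi
      have hmem : (xi n m I J).getD r 0 ∈ xi n m I J := by
        rw [List.getD_eq_getElem _ _ (by omega)]
        exact List.getElem_mem _
      rw [xi_eq, List.mem_append] at hmem
      rcases hmem with hmem | hmem
      · have := h.2.2.2.2.2 _ hmem
        rw [← xi_eq] at this
        omega
      · obtain ⟨c, hc, hc'⟩ := List.mem_map.1 hmem
        have := mem_rowCompl.1 (List.mem_reverse.1 hc)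
        rw [← xi_eq] at hc'
        omega
    | succ k ih =>
      intro r hr
      have := ih (r + 1) (by omega)
      have := h.xi_getD_lt (r := r) (s := r + 1) (by omega) (by omega)
      omega
  exact key (n - 1 - r) r (by omega)

lemma xi_getD_zero_le (h : isTab n m I J) : (xi n m I J).getD 0 0 ≤ m := by
  have hI : 0 < I.length := List.length_pos_iff.2 h.2.1
  rw [h.xi_getD_of_lt hI, List.getD_eq_getElem _ _ (h.1 ▸ hI)]
  exact (h.2.2.2.2.2 _ (List.getElem_mem _)).2

lemma xiInvJ_xi (h : isTab n m I J) : xiInvJ m (xi n m I J) = J := by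
  rw [xiInvJ, xi_eq, List.filter_append, List.filter_eq_self.2, List.filter_eq_nil_iff.2,
    List.append_nil]
  · intro q hq
    obtain ⟨c, hc, rfl⟩ := List.mem_map.1 hq
    have := mem_rowCompl.1 (List.mem_reverse.1 hc)
    simp only [decide_eq_true_eq]
    omega
  · intro j hj
    simpa using (h.2.2.2.2.2 j hj).2

lemma xiInvI_xi (h : isTab n m I J) : xiInvI n m (xi n m I J) = I := by
  refine List.Pairwise.eq_of_mem_iff ((pairwise_lt_range_succ n).filter _)
    h.pairwise_left fun {i} => ?_
  rw [xiInvI, List.mem_filter, mem_range_succ, decide_eq_true_iff, xi_eq, List.mem_append, not_or]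
  constructor
  · rintro ⟨hi, -, hi'⟩
    by_contra hiI
    exact hi' (List.mem_map.2 ⟨i, List.mem_reverse.2 (mem_rowCompl.2 ⟨hi, hiI⟩), rfl⟩)
  · intro hi
    have hin := h.2.2.2.2.1 i hi
    refine ⟨hin, fun hj => ?_, fun hi' => ?_⟩
    · have := h.2.2.2.2.2 _ hj
      omega
    · obtain ⟨c, hc, hci⟩ := List.mem_map.1 hi'
      have hcn := mem_rowCompl.1 (List.mem_reverse.1 hc)
      obtain rfl : c = i := by omega
      exact hcn.2 hi

lemma xi_getD_le_of_tleq {I' J' : List ℕ} (h : isTab n m I J) (h' : isTab n m I' J')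
    (hle : tleq (I, J) (I', J')) {r : ℕ} (hr : r < n) :
    (xi n m I J).getD r 0 ≤ (xi n m I' J').getD r 0 := by
  have hlen := h.length_add_length_rowCompl
  have hlen' := h'.length_add_length_rowCompl
  obtain ⟨hle₁, hle₂⟩ := hle
  dsimp only at hle₁ hle₂
  rcases lt_or_ge r I'.length with h1 | h1
  · rw [h.xi_getD_of_lt (by omega), h'.xi_getD_of_lt h1]
    exact (hle₂ r h1).2
  rw [h'.xi_getD_of_le h1 hr]
  rcases lt_or_ge r I.length with h2 | h2
  · rw [h.xi_getD_of_lt h2, List.getD_eq_getElem _ _ (h.1 ▸ h2)]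
    exact (h.2.2.2.2.2 _ (List.getElem_mem _)).2.trans (by omega)
  rw [h.xi_getD_of_le h2 hr]
  suffices hC : (rowCompl n I').getD (n - 1 - r) 0 ≤ (rowCompl n I).getD (n - 1 - r) 0 by omega
  by_contra! hlt
  set c := (rowCompl n I').getD (n - 1 - r) 0
  have hC := (getD_lt_iff_lt_countP (pairwise_lt_rowCompl n I) c (by omega)).1 hlt
  have hC' := (getD_lt_iff_lt_countP (pairwise_lt_rowCompl n I') c
    (k := n - 1 - r) (by omega)).not.1 (lt_irrefl c)
  have hsum := h.perm_append_rowCompl.countP_eq (decide <| · < c)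
  rw [← h'.perm_append_rowCompl.countP_eq, List.countP_append, List.countP_append] at hsum
  have hlt' : I.countP (decide <| · < c) < I'.countP (decide <| · < c) := by omega
  have hk' := hlt'.trans_le List.countP_le_length
  have h3 := (getD_lt_iff_lt_countP h'.pairwise_left c hk').2 hlt'
  have h4 := (getD_lt_iff_lt_countP h.pairwise_left c (hk'.trans_le hle₁)).1
    ((hle₂ _ hk').1.trans_lt h3)
  exact lt_irrefl _ h4

end isTab

/-- The entry in row `r` and column `q` of a generic band matrix: variables to the left of the
diagonal `q = m + r + 1`, ones on it and zeros to its right. -/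
def bandVar (m r q : ℕ) : MvPolynomial (ℕ × ℕ) ℂ :=
  if q < m + r + 1 then MvPolynomial.X (r, q) else if q = m + r + 1 then 1 else 0

/-- The generic band matrix entry, scaled by the power of `T` recording its weight. -/
def bandEntry (n m N r q : ℕ) : Polynomial (MvPolynomial (ℕ × ℕ) ℂ) :=
  Polynomial.C (bandVar m r q) * Polynomial.X ^ ((m + (r + 1) - q) * N ^ (n - 1 - r))

/-- The maximal minor of the weighted generic band matrix on the columns `K 0, …, K (n - 1)`. -/
def bandMinor (n m N : ℕ) (K : ℕ → ℕ) : Polynomial (MvPolynomial (ℕ × ℕ) ℂ) :=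
  Matrix.det (Matrix.of fun r s : Fin n => bandEntry n m N r (K s))

/-- The weight of a column sequence. -/
def seqWt (n m N : ℕ) (K : ℕ → ℕ) : ℕ :=
  ∑ r : Fin n, (m + ((r : ℕ) + 1) - K r) * N ^ (n - 1 - r)

/-- The exponent of the diagonal monomial of the maximal minor on the columns `K`. -/
def diagExp (n m : ℕ) (K : ℕ → ℕ) : ℕ × ℕ →₀ ℕ :=
  ∑ r : Fin n, if K r < m + r + 1 then Finsupp.single ((r : ℕ), K r) 1 else 0

lemma bandVar_eq_zero {m r q : ℕ} (h : m + r + 1 < q) : bandVar m r q = 0 := by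
  rw [bandVar, if_neg (by omega), if_neg (by omega)]

lemma bandVar_of_le {m r q : ℕ} (h : q ≤ m + r + 1) :
    bandVar m r q =
      MvPolynomial.monomial (if q < m + r + 1 then Finsupp.single (r, q) 1 else 0) 1 := by
  rw [bandVar]
  split_ifs with h1 h2
  · rfl
  · rfl
  · omega

lemma diagExp_apply {n m : ℕ} (K : ℕ → ℕ) {r q : ℕ} (hr : r < n) (hq : q < m + r + 1) :
    diagExp n m K (r, q) = if K r = q then 1 else 0 := by
  rw [diagExp, Finsupp.finsetSum_apply, Finset.sum_eq_single ⟨r, hr⟩]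
  · dsimp only
    split_ifs with h1 h2 h2
    · simp [h2]
    · rw [Finsupp.single_apply, if_neg (by simpa using h2)]
    · omega
    · rfl
  · intro s _ hs
    split_ifs
    · rw [Finsupp.single_apply, if_neg]
      intro h
      exact hs (Fin.ext (Prod.ext_iff.1 h).1)
    · rfl
  · simp

lemma eq_min_max_of_diagExp_add_eq {n m : ℕ} {A B X Y : ℕ → ℕ}
    (hA : ∀ r < n, A r ≤ m + r + 1) (hB : ∀ r < n, B r ≤ m + r + 1)
    (hY : ∀ r < n, Y r ≤ m + r + 1) (hXY : ∀ r < n, X r ≤ Y r)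
    (h : diagExp n m X + diagExp n m Y = diagExp n m A + diagExp n m B) {r : ℕ} (hr : r < n) :
    X r = min (A r) (B r) ∧ Y r = max (A r) (B r) := by
  have key : ∀ q < m + r + 1, (if X r = q then 1 else 0) + (if Y r = q then 1 else 0) =
      (if A r = q then 1 else 0) + (if B r = q then 1 else 0) := by
    intro q hq
    have := DFunLike.congr_fun h (r, q)
    simpa only [Finsupp.add_apply, diagExp_apply _ hr hq] using this
  have hA := hA r hr
  have hB := hB r hr
  have hY := hY r hr
  have hXY := hXY r hr
  have h1 := key (X r)
  have h2 := key (Y r)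
  have h3 := key (A r)
  have h4 := key (B r)
  clear key h
  generalize X r = x at *
  generalize Y r = y at *
  generalize A r = a at *
  generalize B r = b at *
  grind

lemma seqWt_comp_perm_lt {n m N : ℕ} (hN : 1 < N) {K : ℕ → ℕ}
    (hK : ∀ r s : ℕ, r < s → s < n → K r < K s) {σ : Equiv.Perm (Fin n)} (hσ : σ ≠ 1)
    (hle : ∀ r : Fin n, K (σ r) ≤ m + r + 1) (hle' : ∀ r < n, K r ≤ m + r + 1) :
    ∑ r : Fin n, (m + ((r : ℕ) + 1) - K (σ r)) * N ^ (n - 1 - r) < seqWt n m N K := by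
  have hmono : StrictMono fun r : Fin n => (K r : ℤ) := fun r s hrs => by
    exact Nat.cast_lt.2 (hK r s hrs s.2)
  have hanti : StrictAnti fun r : Fin n => (N : ℤ) ^ (n - 1 - (r : ℕ)) := fun r s hrs => by
    have : (r : ℕ) < s := hrs
    exact pow_lt_pow_right₀ (by exact_mod_cast hN) (by omega)
  have hlt : ∑ r : Fin n, (N : ℤ) ^ (n - 1 - (r : ℕ)) * (K r : ℤ) <
      ∑ r : Fin n, (N : ℤ) ^ (n - 1 - (r : ℕ)) * (K (σ r) : ℤ) := by
    refine ((hanti.antitone.antivary hmono.monotone).sum_mul_lt_sum_mul_comp_perm_iff).2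
      fun hv => hσ ?_
    have hσm : Monotone σ := by
      intro r s hrs
      rcases hrs.eq_or_lt with rfl | hrs
      · rfl
      by_contra! hlt
      exact (hv (hmono hlt)).not_gt (hanti hrs)
    have := Subsingleton.elim
      (hσm.strictMono_of_injective σ.injective |>.orderIsoOfSurjective σ σ.surjective)
      (OrderIso.refl (Fin n))
    ext r
    exact congrArg Fin.val (DFunLike.congr_fun this r)
  rw [seqWt]
  zify
  have cast_sub : ∀ (f : Fin n → ℕ), (∀ r : Fin n, f r ≤ m + r + 1) →
      ∑ r : Fin n, ((m + ((r : ℕ) + 1) - f r : ℕ) : ℤ) * (N : ℤ) ^ (n - 1 - (r : ℕ)) =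
      ∑ r : Fin n, ((m + ((r : ℕ) + 1) : ℕ) : ℤ) * (N : ℤ) ^ (n - 1 - (r : ℕ)) -
        ∑ r : Fin n, (N : ℤ) ^ (n - 1 - (r : ℕ)) * (f r : ℤ) := by
    intro f hf
    rw [← Finset.sum_sub_distrib]
    refine Finset.sum_congr rfl fun r _ => ?_
    rw [Nat.cast_sub (by have := hf r; omega)]
    ring
  rw [cast_sub (fun r => K (σ r)) hle, cast_sub (fun r => K r) fun r => hle' r r.2]
  linarith

lemma bandMinor_eq_sum (n m N : ℕ) (K : ℕ → ℕ) :
    bandMinor n m N K = ∑ σ : Equiv.Perm (Fin n), Equiv.Perm.sign σ •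
      (Polynomial.C (∏ r : Fin n, bandVar m r (K (σ r))) *
        Polynomial.X ^ ∑ r : Fin n, (m + ((r : ℕ) + 1) - K (σ r)) * N ^ (n - 1 - r)) := by
  rw [bandMinor, ← Matrix.det_transpose, Matrix.det_apply]
  refine Finset.sum_congr rfl fun σ _ => ?_
  congr 1
  simp only [Matrix.transpose_apply, Matrix.of_apply, bandEntry, Finset.prod_mul_distrib,
    Finset.prod_pow_eq_pow_sum, map_prod]

lemma prod_bandVar_eq_zero_or_lt {n m N : ℕ} (hN : 1 < N) {K : ℕ → ℕ}
    (hK : ∀ r s : ℕ, r < s → s < n → K r < K s) (hle : ∀ r < n, K r ≤ m + r + 1)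
    {σ : Equiv.Perm (Fin n)} (hσ : σ ≠ 1) :
    ∏ r : Fin n, bandVar m r (K (σ r)) = 0 ∨
      ∑ r : Fin n, (m + ((r : ℕ) + 1) - K (σ r)) * N ^ (n - 1 - r) < seqWt n m N K := by
  by_cases h : ∀ r : Fin n, K (σ r) ≤ m + r + 1
  · exact Or.inr (seqWt_comp_perm_lt hN hK hσ h hle)
  · push Not at h
    obtain ⟨r, hr⟩ := h
    exact Or.inl (Finset.prod_eq_zero (Finset.mem_univ r) (bandVar_eq_zero hr))

lemma natDegree_bandMinor_le {n m N : ℕ} (hN : 1 < N) {K : ℕ → ℕ}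
    (hK : ∀ r s : ℕ, r < s → s < n → K r < K s) (hle : ∀ r < n, K r ≤ m + r + 1) :
    (bandMinor n m N K).natDegree ≤ seqWt n m N K := by
  rw [bandMinor_eq_sum]
  refine Polynomial.natDegree_sum_le_of_forall_le _ _ fun σ _ => ?_
  refine (Polynomial.natDegree_smul_le _ _).trans ?_
  by_cases hσ : σ = 1
  · subst hσ
    exact Polynomial.natDegree_C_mul_X_pow_le _ _
  · rcases prod_bandVar_eq_zero_or_lt hN hK hle hσ with h | h
    · simp [h]
    · exact (Polynomial.natDegree_C_mul_X_pow_le _ _).trans h.le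

lemma coeff_bandMinor {n m N : ℕ} (hN : 1 < N) {K : ℕ → ℕ}
    (hK : ∀ r s : ℕ, r < s → s < n → K r < K s) (hle : ∀ r < n, K r ≤ m + r + 1) :
    (bandMinor n m N K).coeff (seqWt n m N K) =
      MvPolynomial.monomial (diagExp n m K) 1 := by
  rw [bandMinor_eq_sum, Polynomial.finsetSum_coeff, Finset.sum_eq_single 1]
  · rw [Equiv.Perm.sign_one, one_smul, Polynomial.coeff_C_mul_X_pow]
    rw [if_pos (by rfl), diagExp, MvPolynomial.monomial_sum_one]
    exact Finset.prod_congr rfl fun r _ => bandVar_of_le (hle r r.2)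
  · intro σ _ hσ
    rw [Polynomial.coeff_smul, Polynomial.coeff_C_mul_X_pow]
    rcases prod_bandVar_eq_zero_or_lt hN hK hle hσ with h | h
    · simp [h]
    · rw [if_neg h.ne', smul_zero]
  · simp

lemma le_and_eq_of_sum_eq {ι σ : Type*} [Fintype ι]
    {F : Polynomial (MvPolynomial σ ℂ)} {P : ι → Polynomial (MvPolynomial σ ℂ)}
    {w : ℕ} {v : ι → ℕ} {e₀ : σ →₀ ℕ} {e : ι → σ →₀ ℕ} {a₀ : ℂ} {a : ι → ℂ}
    (hF : F.natDegree ≤ w) (hFc : F.coeff w = MvPolynomial.monomial e₀ a₀)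
    (hP : ∀ i, (P i).natDegree ≤ v i)
    (hPc : ∀ i, (P i).coeff (v i) = MvPolynomial.monomial (e i) (a i)) (ha : ∀ i, a i ≠ 0)
    (he : Function.Injective e) (h : F = ∑ i, P i) (i : ι) :
    v i ≤ w ∧ (v i = w → e i = e₀) := by
  classical
  have key : ∀ j, (∀ i, v i ≤ v j) → MvPolynomial.coeff (e j) (F.coeff (v j)) = a j := by
    intro j hj
    rw [h, Polynomial.finsetSum_coeff, MvPolynomial.coeff_sum, Finset.sum_eq_single j]
    · rw [hPc, MvPolynomial.coeff_monomial, if_pos rfl]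
    · intro i _ hij
      rcases (hj i).eq_or_lt with hv | hv
      · rw [← hv, hPc, MvPolynomial.coeff_monomial, if_neg (he.ne hij)]
      · rw [Polynomial.coeff_eq_zero_of_natDegree_lt ((hP i).trans_lt hv), MvPolynomial.coeff_zero]
    · simp
  have hle : ∀ i, v i ≤ w := by
    obtain ⟨j, -, hj⟩ := Finset.exists_max_image Finset.univ v ⟨i, Finset.mem_univ i⟩
    refine fun i => (hj i (Finset.mem_univ i)).trans ?_
    by_contra! hlt
    have := key j fun i => hj i (Finset.mem_univ i)
    rw [Polynomial.coeff_eq_zero_of_natDegree_lt (hF.trans_lt hlt), MvPolynomial.coeff_zero] at this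
    exact ha j this.symm
  refine ⟨hle i, fun hi => ?_⟩
  have := key i fun j => hi ▸ hle j
  rw [hi, hFc, MvPolynomial.coeff_monomial] at this
  by_contra hne
  rw [if_neg (Ne.symm hne)] at this
  exact ha i this.symm

/-- The last `n` columns of the weighted generic band matrix. -/
def bandFrame (n m N : ℕ) : Matrix (Fin n) (Fin n) (Polynomial (MvPolynomial (ℕ × ℕ) ℂ)) :=
  Matrix.of fun r s => bandEntry n m N r (m + s + 1)

/-- The first `m` columns of the weighted generic band matrix, normalized so that the last `n`
columns become the identity. -/
def bandSlice (n m N : ℕ) : Matrix (Fin n) (Fin m) (Polynomial (MvPolynomial (ℕ × ℕ) ℂ)) :=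
  (bandFrame n m N)⁻¹ * Matrix.of fun (r : Fin n) (b : Fin m) => bandEntry n m N r (b + 1)

/-- Evaluation of polynomials on `n × m` matrices at the normalized band matrix, with the rows
in reverse order. -/
def bandEval (n m N : ℕ) :
    MvPolynomial (Fin n × Fin m) ℂ →ₐ[ℂ] Polynomial (MvPolynomial (ℕ × ℕ) ℂ) :=
  MvPolynomial.aeval fun p => bandSlice n m N p.1.rev p.2

lemma bandEntry_diag (n m N r : ℕ) : bandEntry n m N r (m + r + 1) = 1 := by
  rw [bandEntry, bandVar, if_neg (lt_irrefl _), if_pos rfl]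
  simp [add_assoc]

lemma det_bandFrame (n m N : ℕ) : (bandFrame n m N).det = 1 := by
  rw [Matrix.det_of_isLowerTriangular]
  · simp [bandFrame, bandEntry_diag]
  · intro r s hrs
    have hrs : r < s := hrs
    rw [bandFrame, Matrix.of_apply, bandEntry, bandVar_eq_zero (by omega), map_zero, zero_mul]

lemma bandFrame_mul_bandSlice (n m N : ℕ) :
    bandFrame n m N * bandSlice n m N = Matrix.of fun (r : Fin n) (b : Fin m) => bandEntry n m N r (b + 1) := by
  rw [bandSlice, ← Matrix.mul_assoc, Matrix.mul_nonsing_inv _ (by simp [det_bandFrame]),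
    Matrix.one_mul]

lemma bandMinor_top (n m N : ℕ) : bandMinor n m N (fun r => m + r + 1) = 1 :=
  det_bandFrame n m N

lemma isTab.exists_xi_getD_eq {n m : ℕ} {I J : List ℕ} (h : isTab n m I J) {r : ℕ}
    (hr : I.length ≤ r) (hrn : r < n) :
    ∃ c, 1 ≤ c ∧ c ≤ n ∧ c ∉ I ∧ (xi n m I J).getD r 0 = m + (n + 1 - c) := by
  have hlen := h.length_add_length_rowCompl
  refine ⟨_, ?_, ?_, ?_, h.xi_getD_of_le hr hrn⟩ <;>
  · have := mem_rowCompl.1 (List.getElem_mem (l := rowCompl n I) (n := n - 1 - r) (by omega))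
    rw [List.getD_eq_getElem _ _ (by omega)]
    tauto

lemma isTab.exists_bandEval_dmin_eq {n m : ℕ} {I J : List ℕ} (h : isTab n m I J) (N : ℕ) :
    ∃ a : ℂ, a ≠ 0 ∧ bandEval n m N (dmin n m I J) =
      a • bandMinor n m N fun r => (xi n m I J).getD r 0 := by
  set K : ℕ → ℕ := fun r => (xi n m I J).getD r 0
  have hlen := h.length_add_length_rowCompl
  have hI : ∀ r < I.length, 1 ≤ I.getD r 0 ∧ I.getD r 0 ≤ n ∧ I.getD r 0 ∈ I := by
    intro r hr
    rw [List.getD_eq_getElem _ _ hr]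
    have := h.2.2.2.2.1 _ (List.getElem_mem hr)
    exact ⟨this.1, this.2, List.getElem_mem hr⟩
  have hJ : ∀ r < I.length, 1 ≤ J.getD r 0 ∧ J.getD r 0 ≤ m ∧ K r = J.getD r 0 := by
    intro r hr
    refine ⟨?_, ?_, h.xi_getD_of_lt hr⟩ <;>
    · rw [List.getD_eq_getElem _ _ (h.1 ▸ hr)]
      have := h.2.2.2.2.2 _ (List.getElem_mem (h.1 ▸ hr : r < J.length))
      tauto
  have hIlt : ∀ r s, r < s → s < I.length → I.getD r 0 < I.getD s 0 := by
    intro r s hrs hs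
    rw [List.getD_eq_getElem _ _ hs, List.getD_eq_getElem _ _ (hrs.trans hs)]
    exact List.pairwise_iff_getElem.1 h.pairwise_left _ _ _ _ hrs
  have hKlt : ∀ r s, r < s → s < n → K r < K s := fun r s => h.xi_getD_lt
  let V : Matrix (Fin n) (Fin n) (Polynomial (MvPolynomial (ℕ × ℕ) ℂ)) :=
    Matrix.of fun r s => if hs : (s : ℕ) < I.length then
      bandSlice n m N r ⟨J.getD s 0 - 1, by have := hJ s hs; omega⟩
      else if m + r + 1 = K s then 1 else 0
  have hV : (bandFrame n m N * V).det = bandMinor n m N K := by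
    rw [bandMinor]
    congr 1
    ext1 r s
    rw [Matrix.of_apply]
    by_cases hs : (s : ℕ) < I.length
    · have hJs := hJ s hs
      have := congrFun (congrFun (bandFrame_mul_bandSlice n m N) r)
        ⟨J.getD s 0 - 1, by omega⟩
      rw [Matrix.of_apply, Matrix.mul_apply] at this
      simp only [Matrix.mul_apply, V, Matrix.of_apply, dif_pos hs]
      rw [this]
      congr 1
      dsimp only
      omega
    · obtain ⟨c, hc1, hcn, -, hc⟩ := h.exists_xi_getD_eq (not_lt.1 hs) s.2
      have hc : K s = m + (n + 1 - c) := hc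
      simp only [Matrix.mul_apply, V, Matrix.of_apply, dif_neg hs]
      rw [Finset.sum_eq_single ⟨n - c, by omega⟩]
      · rw [if_pos (by dsimp only; omega), mul_one, bandFrame, Matrix.of_apply]
        congr 1
        dsimp only
        omega
      · intro t _ ht
        rw [if_neg, mul_zero]
        intro h'
        exact ht (Fin.ext (by dsimp only; omega))
      · simp
  rw [Matrix.det_mul, det_bandFrame, one_mul] at hV
  let ρ : Fin n → Fin n := fun r => if hr : (r : ℕ) < I.length then
    ⟨n - I.getD r 0, by have := hI r hr; omega⟩
    else ⟨K r - (m + 1), by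
      obtain ⟨c, hc1, hcn, -, hc⟩ := h.exists_xi_getD_eq (not_lt.1 hr) r.2
      have hc : K r = m + (n + 1 - c) := hc
      omega⟩
  have hρ_lt : ∀ r : Fin n, (r : ℕ) < I.length → (ρ r : ℕ) = n - I.getD r 0 := by
    intro r hr
    simp only [ρ, dif_pos hr]
  have hρ_ge : ∀ r : Fin n, ¬ (r : ℕ) < I.length → m + (ρ r : ℕ) + 1 = K r := by
    intro r hr
    obtain ⟨c, hc1, hcn, -, hc⟩ := h.exists_xi_getD_eq (not_lt.1 hr) r.2
    have hc : K r = m + (n + 1 - c) := hc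
    simp only [ρ, dif_neg hr]
    omega
  have hρ_ne : ∀ r s : Fin n, r < s → ρ r ≠ ρ s := by
    intro r s hrs heq
    have heq := congrArg Fin.val heq
    by_cases hs : (s : ℕ) < I.length
    · have hr : (r : ℕ) < I.length := lt_trans hrs hs
      rw [hρ_lt r hr, hρ_lt s hs] at heq
      have := hIlt r s hrs hs
      have := hI s hs
      omega
    have h1 := hρ_ge s hs
    by_cases hr : (r : ℕ) < I.length
    · obtain ⟨c, hc1, hcn, hcI, hc⟩ := h.exists_xi_getD_eq (not_lt.1 hs) s.2
      have hc : K s = m + (n + 1 - c) := hc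
      rw [hρ_lt r hr] at heq
      have hIr := hI r hr
      have : I.getD r 0 = c := by omega
      exact hcI (this ▸ hIr.2.2)
    · have h2 := hρ_ge r hr
      have := hKlt r s hrs s.2
      omega
  have hρ : Function.Injective ρ := by
    intro r s heq
    by_contra hne
    rcases lt_or_gt_of_ne hne with hlt | hlt
    · exact hρ_ne r s hlt heq
    · exact hρ_ne s r hlt heq.symm
  let σ : Equiv.Perm (Fin n) := Equiv.ofBijective ρ (Finite.injective_iff_bijective.1 hρ)
  have hB : (V.submatrix σ id).det = bandEval n m N (dmin n m I J) := by
    have hcol : ∀ r s : Fin n, ¬ (s : ℕ) < I.length →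
        V.submatrix σ id r s = if r = s then 1 else 0 := by
      intro r s hs
      have : V.submatrix σ id r s = if m + (ρ r : ℕ) + 1 = K s then 1 else 0 := by
        simp only [Matrix.submatrix_apply, V, Matrix.of_apply, id, dif_neg hs]
        rfl
      rw [this, ← hρ_ge s hs]
      refine if_congr ?_ rfl rfl
      rw [← hρ.eq_iff, Fin.ext_iff]
      omega
    rw [Matrix.twoBlockTriangular_det' _ (fun r : Fin n => (r : ℕ) < I.length)]
    · have hone : (V.submatrix σ id).toSquareBlockProp
          (fun r : Fin n => ¬ (r : ℕ) < I.length) = 1 := by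
        ext1 r s
        rw [Matrix.one_apply]
        refine (hcol _ _ s.2).trans ?_
        exact if_congr Subtype.ext_iff.symm rfl rfl
      rw [hone, Matrix.det_one, mul_one]
      let e : Fin I.length ≃ {r : Fin n // (r : ℕ) < I.length} :=
        { toFun := fun r => ⟨⟨r, by omega⟩, r.2⟩
          invFun := fun r => ⟨r.1, r.2⟩
          left_inv := fun _ => rfl
          right_inv := fun _ => rfl }
      rw [← Matrix.det_submatrix_equiv_self e, dmin, AlgHom.map_det]
      congr 1
      ext1 r s
      have hr := hI r r.2
      have hs := hJ s s.2
      rw [AlgHom.mapMatrix_apply, Matrix.map_apply, Matrix.of_apply,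
        dif_pos ⟨by omega, by omega⟩, bandEval, MvPolynomial.aeval_X]
      have hse : ((e s : Fin n) : ℕ) < I.length := s.2
      refine (dif_pos hse : V (σ (e r)) (e s) = _).trans ?_
      congr 1
      apply Fin.ext
      rw [Fin.val_rev]
      refine (hρ_lt _ (show ((e r : Fin n) : ℕ) < I.length from r.2)).trans ?_
      change n - I.getD r 0 = n - (I.getD r 0 - 1 + 1)
      omega
    · intro r hr s hs
      rw [hcol r s hs, if_neg]
      rintro rfl
      exact hs hr
  rw [Matrix.det_permute, hV] at hB
  refine ⟨((Equiv.Perm.sign σ : ℤ) : ℂ), by simp, ?_⟩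
  rw [← hB, Algebra.smul_def, map_intCast]

/-- The column sequence of an optional one-line tableau, `none` being the empty tableau. -/
def tabSeq (n m : ℕ) (o : Option (List ℕ × List ℕ)) (r : ℕ) : ℕ :=
  o.elim (m + r + 1) fun t => (xi n m t.1 t.2).getD r 0

section tabSeq

variable {n m : ℕ} {o : Option (List ℕ × List ℕ)}

lemma tabSeq_lt (ho : o.elim True fun t => isTab n m t.1 t.2) (r s : ℕ) (hrs : r < s)
    (hs : s < n) : tabSeq n m o r < tabSeq n m o s := by
  cases o with
  | none => simp only [tabSeq, Option.elim_none]; omega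
  | some t => exact isTab.xi_getD_lt ho hrs hs

lemma tabSeq_le (ho : o.elim True fun t => isTab n m t.1 t.2) (r : ℕ) (hr : r < n) :
    tabSeq n m o r ≤ m + r + 1 := by
  cases o with
  | none => exact le_rfl
  | some t => exact isTab.xi_getD_le ho hr

lemma seqWt_tabSeq (n m N : ℕ) (o : Option (List ℕ × List ℕ)) :
    seqWt n m N (tabSeq n m o) = o.elim 0 (wtTab n m N) := by
  cases o with
  | none => simp [seqWt, tabSeq, add_assoc]
  | some t =>
    exact Fin.sum_univ_eq_sum_range
      (fun r => (m + (r + 1) - (xi n m t.1 t.2).getD r 0) * N ^ (n - 1 - r)) n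

lemma exists_bandEval_eq (ho : o.elim True fun t => isTab n m t.1 t.2) (N : ℕ) :
    ∃ a : ℂ, a ≠ 0 ∧ bandEval n m N (o.elim 1 fun t => dmin n m t.1 t.2) =
      a • bandMinor n m N (tabSeq n m o) := by
  cases o with
  | none => exact ⟨1, one_ne_zero, by
      rw [Option.elim_none, map_one, one_smul]; exact (bandMinor_top n m N).symm⟩
  | some t => exact isTab.exists_bandEval_dmin_eq ho N

/-- The leading term of a product of two minors, evaluated at the normalized band matrix. -/
lemma exists_leading_bandEval_mul {N : ℕ} (hN : 1 < N) {o' : Option (List ℕ × List ℕ)}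
    (ho : o.elim True fun t => isTab n m t.1 t.2)
    (ho' : o'.elim True fun t => isTab n m t.1 t.2) :
    ∃ a : ℂ, a ≠ 0 ∧
      (bandEval n m N ((o.elim 1 fun t => dmin n m t.1 t.2) *
        o'.elim 1 fun t => dmin n m t.1 t.2)).natDegree ≤
          o.elim 0 (wtTab n m N) + o'.elim 0 (wtTab n m N) ∧
      (bandEval n m N ((o.elim 1 fun t => dmin n m t.1 t.2) *
        o'.elim 1 fun t => dmin n m t.1 t.2)).coeff
          (o.elim 0 (wtTab n m N) + o'.elim 0 (wtTab n m N)) =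
        MvPolynomial.monomial (diagExp n m (tabSeq n m o) + diagExp n m (tabSeq n m o')) a := by
  obtain ⟨a, ha, hae⟩ := exists_bandEval_eq ho N
  obtain ⟨a', ha', hae'⟩ := exists_bandEval_eq ho' N
  have hd := natDegree_bandMinor_le hN (tabSeq_lt ho) (tabSeq_le ho)
  have hd' := natDegree_bandMinor_le hN (tabSeq_lt ho') (tabSeq_le ho')
  refine ⟨a * a', mul_ne_zero ha ha', ?_⟩
  rw [map_mul, hae, hae', smul_mul_smul_comm, ← seqWt_tabSeq, ← seqWt_tabSeq]
  constructor
  · exact (Polynomial.natDegree_smul_le _ _).trans (Polynomial.natDegree_mul_le_of_le hd hd')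
  · rw [Polynomial.coeff_smul, Polynomial.coeff_mul_add_eq_of_natDegree_le hd hd',
      coeff_bandMinor hN (tabSeq_lt ho) (tabSeq_le ho),
      coeff_bandMinor hN (tabSeq_lt ho') (tabSeq_le ho'), MvPolynomial.monomial_mul,
      MvPolynomial.smul_monomial]
    simp

end tabSeq

lemma eq_xiInv_of_tabSeq_eq {n m : ℕ} {t : List ℕ × List ℕ} (ht : isTab n m t.1 t.2)
    {K : List ℕ} (hK : K.length = n) (h : ∀ r < n, tabSeq n m (some t) r = K.getD r 0) :
    t = (xiInvI n m K, xiInvJ m K) := by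
  have : xi n m t.1 t.2 = K := by
    refine List.ext_getElem (ht.length_xi.trans hK.symm) fun r hr hr' => ?_
    have := h r (hK ▸ hr')
    rwa [List.getD_eq_getElem _ _ hr', tabSeq, Option.elim_some, List.getD_eq_getElem _ _ hr]
      at this
  rw [← this, ht.xiInvI_xi, ht.xiInvJ_xi]

lemma tabSeq_injOn {n m : ℕ} (hn : 0 < n) {o o' : Option (List ℕ × List ℕ)}
    (ho : o.elim True fun t => isTab n m t.1 t.2)
    (ho' : o'.elim True fun t => isTab n m t.1 t.2)
    (h : ∀ r < n, tabSeq n m o r = tabSeq n m o' r) : o = o' := by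
  cases o with
  | none =>
    cases o' with
    | none => rfl
    | some t' =>
      have h1 : m + 0 + 1 = _ := h 0 hn
      have h2 : tabSeq n m (some t') 0 ≤ m := isTab.xi_getD_zero_le ho'
      omega
  | some t =>
    cases o' with
    | none =>
      have h1 : _ = m + 0 + 1 := h 0 hn
      have h2 : tabSeq n m (some t) 0 ≤ m := isTab.xi_getD_zero_le ho
      omega
    | some t' =>
      rw [eq_xiInv_of_tabSeq_eq ho (isTab.length_xi ho') h, isTab.xiInvI_xi ho',
        isTab.xiInvJ_xi ho']

lemma tabSeq_mono {n m : ℕ} {t : List ℕ × List ℕ} (ht : isTab n m t.1 t.2)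
    {o : Option (List ℕ × List ℕ)}
    (ho : o.elim True fun y => isTab n m y.1 y.2 ∧ tleq t y) (r : ℕ) (hr : r < n) :
    tabSeq n m (some t) r ≤ tabSeq n m o r := by
  cases o with
  | none => exact ht.xi_getD_le hr
  | some y => exact ht.xi_getD_le_of_tleq ho.1 ho.2 hr

lemma getD_zipWith_xi {n m : ℕ} {A B : List ℕ × List ℕ} (hA : isTab n m A.1 A.2)
    (hB : isTab n m B.1 B.2) (f : ℕ → ℕ → ℕ) {r : ℕ} (hr : r < n) :
    (List.zipWith f (xi n m A.1 A.2) (xi n m B.1 B.2)).getD r 0 =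
      f (tabSeq n m (some A) r) (tabSeq n m (some B) r) := by
  have hlA := hA.length_xi
  have hlB := hB.length_xi
  rw [List.getD_eq_getElem _ _ (by simp; omega), List.getElem_zipWith, tabSeq, tabSeq,
    Option.elim_some, Option.elim_some, List.getD_eq_getElem _ _ (by omega),
    List.getD_eq_getElem _ _ (by omega)]

/-- Proposition `stmD`. Let `δ_A δ_B = ∑ c_r δ_{X_r} δ_{Y_r}` be the
standard expression of `δ_A δ_B` in `ℂ[M_{n,m}]` (all terms standard and distinct, with
nonzero coefficients; `δ_{Y_r}` may be absent). Then
`wt(A) + wt(B) ≥ wt(X_r) + wt(Y_r)` for every `r`, with equality only for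
`(X_r, Y_r) = (A∧B, A∨B)`. -/
theorem weight_decreases_in_straightening (n m N : ℕ) (hn : 0 < n) (hm : 0 < m)
    (hN : 2 * (n + m) < N) (A B : List ℕ × List ℕ)
    (hA : isTab n m A.1 A.2) (hB : isTab n m B.1 B.2)
    (u : ℕ) (c : Fin u → ℂ) (X : Fin u → List ℕ × List ℕ)
    (Y : Fin u → Option (List ℕ × List ℕ))
    (hstd : ∀ r, isTab n m (X r).1 (X r).2 ∧
      (Y r).elim True (fun y => isTab n m y.1 y.2 ∧ tleq (X r) y))
    (hdist : Function.Injective fun r => (X r, Y r))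
    (hc : ∀ r, c r ≠ 0)
    (heq : dmin n m A.1 A.2 * dmin n m B.1 B.2 =
      ∑ r, c r • (dmin n m (X r).1 (X r).2 *
        (Y r).elim 1 (fun y => dmin n m y.1 y.2))) :
    ∀ r, wtTab n m N (X r) + (Y r).elim 0 (wtTab n m N) ≤ wtTab n m N A + wtTab n m N B ∧
      (wtTab n m N (X r) + (Y r).elim 0 (wtTab n m N) = wtTab n m N A + wtTab n m N B →
        X r = tabMeet n m A B ∧ Y r = some (tabJoin n m A B)) := by
  have hY : ∀ r, (Y r).elim True fun y => isTab n m y.1 y.2 := fun r => by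
    have := (hstd r).2
    cases h : Y r with
    | none => trivial
    | some y => rw [h] at this; exact this.1
  have hX : ∀ r, (some (X r)).elim True fun y => isTab n m y.1 y.2 := fun r => (hstd r).1
  have hXY : ∀ r, ∀ k < n, tabSeq n m (some (X r)) k ≤ tabSeq n m (Y r) k :=
    fun r => tabSeq_mono (hstd r).1 (hstd r).2
  have hN1 : 1 < N := by omega
  obtain ⟨a₀, -, hdeg, hcoeff⟩ := exists_leading_bandEval_mul (n := n) (m := m) (o := some A)
    (o' := some B) hN1 hA hB
  choose a ha hdegr hcoeffr using fun r => exists_leading_bandEval_mul hN1 (hX r) (hY r)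
  have hinj : Function.Injective fun r =>
      diagExp n m (tabSeq n m (some (X r))) + diagExp n m (tabSeq n m (Y r)) := by
    intro r s hrs
    have key := fun k hk => eq_min_max_of_diagExp_add_eq (tabSeq_le (hX s)) (tabSeq_le (hY s))
      (tabSeq_le (hY r)) (hXY r) hrs (r := k) hk
    have h1 := tabSeq_injOn hn (hX r) (hX s) fun k hk =>
      (key k hk).1.trans (min_eq_left (hXY s k hk))
    have h2 := tabSeq_injOn hn (hY r) (hY s) fun k hk =>
      (key k hk).2.trans (max_eq_right (hXY s k hk))
    exact hdist (Prod.ext (Option.some_injective _ h1) h2)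
  have hsum := congrArg (bandEval n m N) heq
  rw [map_sum] at hsum
  intro r
  have main := le_and_eq_of_sum_eq hdeg hcoeff
    (P := fun r => bandEval n m N (c r • (dmin n m (X r).1 (X r).2 *
        (Y r).elim 1 (fun y => dmin n m y.1 y.2))))
    (v := fun r => wtTab n m N (X r) + (Y r).elim 0 (wtTab n m N)) (a := fun r => c r * a r)
    (fun r => by
      rw [map_smul]
      exact (Polynomial.natDegree_smul_le _ _).trans (hdegr r))
    (fun r => by
      rw [map_smul, Polynomial.coeff_smul]
      refine (congrArg (c r • ·) (hcoeffr r)).trans ?_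
      rw [MvPolynomial.smul_monomial, smul_eq_mul])
    (fun r => mul_ne_zero (hc r) (ha r)) hinj hsum r
  refine ⟨main.1, fun hw => ?_⟩
  have key := fun k hk => eq_min_max_of_diagExp_add_eq (tabSeq_le (o := some A) hA)
    (tabSeq_le (o := some B) hB) (tabSeq_le (hY r)) (hXY r) (main.2 hw) (r := k) hk
  have hlen : ∀ f : ℕ → ℕ → ℕ,
      (List.zipWith f (xi n m A.1 A.2) (xi n m B.1 B.2)).length = n := fun f => by
    rw [List.length_zipWith, hA.length_xi, hB.length_xi, min_self]
  refine ⟨eq_xiInv_of_tabSeq_eq (hX r) (hlen _) fun k hk =>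
    (key k hk).1.trans (getD_zipWith_xi hA hB min hk).symm, ?_⟩
  have hYr := hY r
  cases hy : Y r with
  | none =>
    have h1 := (key 0 hn).2
    rw [hy] at h1
    have h2 : tabSeq n m (some A) 0 ≤ m := hA.xi_getD_zero_le
    have h3 : tabSeq n m (some B) 0 ≤ m := hB.xi_getD_zero_le
    have h4 : m + 0 + 1 = max (tabSeq n m (some A) 0) (tabSeq n m (some B) 0) := h1
    omega
  | some y =>
    rw [hy] at hYr key
    exact congrArg some (eq_xiInv_of_tabSeq_eq hYr (hlen _) fun k hk =>
      (key k hk).2.trans (getD_zipWith_xi hA hB max hk).symm)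

end
end
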